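/- Let ω be a radial weight in the class D̂, let 1<p<∞ and 0<q≤1, with p'=p/(p−1), and set μ_q = ω·ω̂^{1/q}. Then (A^{p,q}_ω)* ≃ A^{p',∞}_ω under the A²_{μ_q}-pairing with equivalence of norms: there exist constants C₁,C₂>0 (depending only on p,q,ω) such that (a) for every g with ‖g‖_{A^{p',∞}_ω}<∞ and every f∈A^{p,q}_ω the limit defining ⟨f,g⟩_{A²_{μ_q}} exists and L_g(f)=⟨f,g⟩_{A²_{μ_q}} defines a bounded linear functional on A^{p,q}_ω with ‖L_g‖ ≤ C₂‖g‖_{A^{p',∞}_ω}, and (b) every bounded linear functional L on A^{p,q}_ω equals L_g for some g with ‖g‖_{A^{p',∞}_ω} ≤ C₁‖L‖. -/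

import Mathlib

open MeasureTheory Filter Set
open scoped ENNReal

noncomputable section

/-- `ω̂(r) = ∫_r^1 ω(s) ds`. -/
def omegaHat (ω : ℝ → ℝ) (r : ℝ) : ℝ := ∫ s in r..1, ω s

/-- A radial weight: nonnegative and Lebesgue integrable on `[0,1)`. -/
def IsRadialWeight (ω : ℝ → ℝ) : Prop :=
  (∀ r ∈ Set.Ico (0:ℝ) 1, 0 ≤ ω r) ∧ MeasureTheory.IntegrableOn ω (Set.Ico 0 1)

/-- The class `D̂` of upper doubling radial weights. -/
def InDhat (ω : ℝ → ℝ) : Prop :=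
  ∃ C > (0:ℝ), ∀ r ∈ Set.Ico (0:ℝ) 1, omegaHat ω r ≤ C * omegaHat ω ((1 + r) / 2)

/-- The class `Ď`. -/
def InDcheck (ω : ℝ → ℝ) : Prop :=
  ∃ K > (1:ℝ), ∃ C > (1:ℝ), ∀ r ∈ Set.Ico (0:ℝ) 1,
    C * omegaHat ω (1 - (1 - r) / K) ≤ omegaHat ω r

/-- Moments `μ_x = ∫_0^1 r^x μ(r) dr`. -/
def momentW (μ : ℝ → ℝ) (x : ℝ) : ℝ := ∫ r in (0:ℝ)..1, r ^ x * μ r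

/-- The coefficients `μ_{2k+1}` of the `A²_μ` pairing. -/
def momentCoeff (μ : ℝ → ℝ) : ℕ → ℝ := fun k => momentW μ (2 * (k:ℝ) + 1)

/-- The point `r e^{iθ}` of the circle of radius `r`. -/
def circlePt (r θ : ℝ) : ℂ := (r:ℂ) * Complex.exp ((θ:ℂ) * Complex.I)

/-- Integral means `M_p(r,f)` (with values in `[0,∞]`). -/
def MpE (p r : ℝ) (f : ℂ → ℂ) : ℝ≥0∞ :=
  (ENNReal.ofReal (1 / (2 * Real.pi)) *
    ∫⁻ θ in Set.Ioo (0:ℝ) (2 * Real.pi), ENNReal.ofReal (‖f (circlePt r θ)‖ ^ p)) ^ (1 / p)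

/-- Integral means of a `[0,∞]`-valued function. -/
def MpEE (p r : ℝ) (F : ℂ → ℝ≥0∞) : ℝ≥0∞ :=
  (ENNReal.ofReal (1 / (2 * Real.pi)) *
    ∫⁻ θ in Set.Ioo (0:ℝ) (2 * Real.pi), (F (circlePt r θ)) ^ p) ^ (1 / p)

/-- The norm of the mixed norm space `L^{p,q}_ω`. -/
def LpqNormE (ω : ℝ → ℝ) (p q : ℝ) (f : ℂ → ℂ) : ℝ≥0∞ :=
  (∫⁻ r in Set.Ioo (0:ℝ) 1, (MpE p r f) ^ q * ENNReal.ofReal (r * ω r)) ^ (1 / q)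

/-- The `L^{p,q}_ω` norm of a `[0,∞]`-valued function. -/
def LpqNormEE (ω : ℝ → ℝ) (p q : ℝ) (F : ℂ → ℝ≥0∞) : ℝ≥0∞ :=
  (∫⁻ r in Set.Ioo (0:ℝ) 1, (MpEE p r F) ^ q * ENNReal.ofReal (r * ω r)) ^ (1 / q)

/-- The norm of `A^{p,∞}_ω` : `sup_{0 ≤ r < 1} M_p(r,f) ω̂(r)`. -/
def ApInfNormE (ω : ℝ → ℝ) (p : ℝ) (f : ℂ → ℂ) : ℝ≥0∞ :=
  ⨆ r ∈ Set.Ico (0:ℝ) 1, MpE p r f * ENNReal.ofReal (omegaHat ω r)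

/-- Membership in the mixed norm space `A^{p,q}_ω`. -/
def InApq (ω : ℝ → ℝ) (p q : ℝ) (f : ℂ → ℂ) : Prop :=
  DifferentiableOn ℂ f (Metric.ball 0 1) ∧ LpqNormE ω p q f < ⊤

/-- Membership in `A^{p,∞}_ω`. -/
def InApInf (ω : ℝ → ℝ) (p : ℝ) (f : ℂ → ℂ) : Prop :=
  DifferentiableOn ℂ f (Metric.ball 0 1) ∧ ApInfNormE ω p f < ⊤

/-- Taylor coefficient of `f` at `0`. -/
def taylorCoeff (f : ℂ → ℂ) (n : ℕ) : ℂ := iteratedDeriv n f 0 / (n.factorial : ℂ)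

/-- The pairing `⟨f,g⟩ = lim_{r→1⁻} ∑_k f̂(k) conj(ĝ(k)) c(k) r^k` exists and equals `l`. -/
def HasPairingC (c : ℕ → ℝ) (f g : ℂ → ℂ) (l : ℂ) : Prop :=
  (∀ r ∈ Set.Ico (0:ℝ) 1, Summable (fun k : ℕ =>
    taylorCoeff f k * (starRingEnd ℂ) (taylorCoeff g k) * ((c k : ℝ) : ℂ) * ((r:ℂ)) ^ k)) ∧
  Filter.Tendsto (fun r : ℝ => ∑' k : ℕ,
    taylorCoeff f k * (starRingEnd ℂ) (taylorCoeff g k) * ((c k : ℝ) : ℂ) * ((r:ℂ)) ^ k)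
    (nhdsWithin 1 (Set.Iio 1)) (nhds l)

/-- `L` is linear on the functions satisfying `P`. -/
def IsLinearOn (P : (ℂ → ℂ) → Prop) (L : (ℂ → ℂ) → ℂ) : Prop :=
  (∀ f g : ℂ → ℂ, P f → P g → L (f + g) = L f + L g) ∧
  (∀ (c : ℂ) (f : ℂ → ℂ), P f → L (c • f) = c * L f)

/-- Dilation `f_r(z) = f(rz)`. -/
def dilateF (f : ℂ → ℂ) (r : ℝ) : ℂ → ℂ := fun z => f ((r:ℂ) * z)

/-- The BMOA norm `|f(0)| + sup_{a∈D} sup_{0<r<1} M₂(r, f∘φ_a - f(a))`. -/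
def BMOANormE (f : ℂ → ℂ) : ℝ≥0∞ :=
  ENNReal.ofReal ‖f 0‖ +
    ⨆ a ∈ Metric.ball (0:ℂ) 1, ⨆ r ∈ Set.Ioo (0:ℝ) 1,
      MpE 2 r (fun z => f ((a - z) / (1 - (starRingEnd ℂ) a * z)) - f a)

/-- The Bloch norm `|f(0)| + sup_{z∈D} (1-|z|²)|f'(z)|`. -/
def BlochNormE (f : ℂ → ℂ) : ℝ≥0∞ :=
  ENNReal.ofReal ‖f 0‖ +
    ⨆ z ∈ Metric.ball (0:ℂ) 1, ENNReal.ofReal ((1 - ‖z‖ ^ 2) * ‖deriv f z‖)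

/-- The norm of `X(q,ω)`: `(∫_0^1 ‖f_r‖_X^q ω(r) dr)^{1/q}`. -/
def XqNormE (Xnorm : (ℂ → ℂ) → ℝ≥0∞) (ω : ℝ → ℝ) (q : ℝ) (f : ℂ → ℂ) : ℝ≥0∞ :=
  (∫⁻ r in Set.Ioo (0:ℝ) 1, (Xnorm (dilateF f r)) ^ q * ENNReal.ofReal (ω r)) ^ (1 / q)

/-- The norm of `X(∞,ω)`: `sup_{0<r<1} ‖f_r‖_X ω̂(r)`. -/
def XInfNormE (Xnorm : (ℂ → ℂ) → ℝ≥0∞) (ω : ℝ → ℝ) (f : ℂ → ℂ) : ℝ≥0∞ :=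
  ⨆ r ∈ Set.Ioo (0:ℝ) 1, Xnorm (dilateF f r) * ENNReal.ofReal (omegaHat ω r)

/-- The standard radial weight `ν_β(r) = (β+1)(1-r²)^β`. -/
def nuWeight (β : ℝ) : ℝ → ℝ := fun r => (β + 1) * (1 - r ^ 2) ^ β

/-- The Bergman reproducing kernel `B^ω_a(z) = ∑ (z conj a)^n / (2 ω_{2n+1})`. -/
def bergmanKernel (ω : ℝ → ℝ) (a z : ℂ) : ℂ :=
  ∑' n : ℕ, (z * (starRingEnd ℂ) a) ^ n / (2 * ((momentW ω (2 * (n:ℝ) + 1) : ℝ) : ℂ))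

/-- The Bergman projection (`dA` is normalized area measure). -/
def PomegaProj (ω : ℝ → ℝ) (f : ℂ → ℂ) (z : ℂ) : ℂ :=
  (Real.pi)⁻¹ • ∫ ζ in Metric.ball (0:ℂ) 1,
    f ζ * (starRingEnd ℂ) (bergmanKernel ω z ζ) * ((ω ‖ζ‖ : ℝ) : ℂ)

/-- The maximal Bergman projection applied to `|f|`, with values in `[0,∞]`. -/
def PomegaPlusL (ω : ℝ → ℝ) (f : ℂ → ℂ) (z : ℂ) : ℝ≥0∞ :=
  ∫⁻ ζ in Metric.ball (0:ℂ) 1,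
    ENNReal.ofReal (‖f ζ‖ * ‖bergmanKernel ω z ζ‖ * ω ‖ζ‖ / Real.pi)

/-- The Hardy `H¹` norm. -/
def H1NormE (f : ℂ → ℂ) : ℝ≥0∞ := ⨆ r ∈ Set.Ioo (0:ℝ) 1, MpE 1 r f

/-- `r_n = inf{ r ∈ [0,1) : ω̂(r) = ω̂(0) K^{-n} }`. -/
def rSeq (ω : ℝ → ℝ) (K : ℝ) (n : ℕ) : ℝ :=
  sInf {r | r ∈ Set.Ico (0:ℝ) 1 ∧ omegaHat ω r = omegaHat ω 0 * K ^ (-(n:ℝ))}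

/-- `M_n = ⌊1/(1-r_n)⌋`. -/
def MSeq (ω : ℝ → ℝ) (K : ℝ) (n : ℕ) : ℕ := ⌊1 / (1 - rSeq ω K n)⌋₊

/-- Weighted Hadamard product of a polynomial with an analytic function:
`z ↦ ∑_j c(j) P̂(j) ĝ(j) z^j`. -/
def hadamardPolyC (c : ℕ → ℂ) (P : Polynomial ℂ) (g : ℂ → ℂ) : ℂ → ℂ :=
  fun z => ∑ j ∈ Finset.range (P.natDegree + 1), c j * P.coeff j * taylorCoeff g j * z ^ j

/-- An admissible Banach space of analytic functions on the unit disc, given by a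
carrier set and a norm function. -/
structure AdmissibleSpace where
  carrier : Set (ℂ → ℂ)
  nrm : (ℂ → ℂ) → ℝ
  mem_analytic : ∀ f ∈ carrier, DifferentiableOn ℂ f (Metric.ball 0 1)
  zero_mem : (0 : ℂ → ℂ) ∈ carrier
  add_mem : ∀ f g : ℂ → ℂ, f ∈ carrier → g ∈ carrier → f + g ∈ carrier
  smul_mem : ∀ (c : ℂ) (f : ℂ → ℂ), f ∈ carrier → c • f ∈ carrier
  nrm_nonneg : ∀ f ∈ carrier, 0 ≤ nrm f
  nrm_eq_zero : ∀ f ∈ carrier, nrm f = 0 → ∀ z ∈ Metric.ball (0:ℂ) 1, f z = 0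
  nrm_add : ∀ f g : ℂ → ℂ, f ∈ carrier → g ∈ carrier → nrm (f + g) ≤ nrm f + nrm g
  nrm_smul : ∀ (c : ℂ) (f : ℂ → ℂ), f ∈ carrier → nrm (c • f) = ‖c‖ * nrm f
  complete : ∀ u : ℕ → (ℂ → ℂ), (∀ n, u n ∈ carrier) →
    (∀ ε : ℝ, 0 < ε → ∃ N : ℕ, ∀ m ≥ N, ∀ n ≥ N, nrm (u m - u n) < ε) →
    ∃ f ∈ carrier, Filter.Tendsto (fun n => nrm (u n - f)) Filter.atTop (nhds 0)
  norm_conv_implies_ucc : ∀ (u : ℕ → (ℂ → ℂ)) (f : ℂ → ℂ),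
    (∀ n, u n ∈ carrier) → f ∈ carrier →
    Filter.Tendsto (fun n => nrm (u n - f)) Filter.atTop (nhds 0) →
    ∀ Kc : Set ℂ, Kc ⊆ Metric.ball 0 1 → IsCompact Kc →
      TendstoUniformlyOn (fun n => u n) f Filter.atTop Kc
  ucc_implies_norm_conv : ∀ R : ℝ, 1 < R → ∀ (u : ℕ → (ℂ → ℂ)) (f : ℂ → ℂ),
    (∀ n, u n ∈ carrier ∧ DifferentiableOn ℂ (u n) (Metric.ball 0 R)) →
    DifferentiableOn ℂ f (Metric.ball 0 R) →
    (∀ Kc : Set ℂ, Kc ⊆ Metric.ball (0:ℂ) R → IsCompact Kc →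
      TendstoUniformlyOn (fun n => u n) f Filter.atTop Kc) →
    f ∈ carrier ∧ Filter.Tendsto (fun n => nrm (u n - f)) Filter.atTop (nhds 0)
  dilation_bound : ∃ C > (0:ℝ), ∀ f ∈ carrier, ∀ ζ : ℂ, ‖ζ‖ ≤ 1 →
    (fun z => f (ζ * z)) ∈ carrier ∧ nrm (fun z => f (ζ * z)) ≤ C * nrm f

/-- The operator `T_p = I^{ν_{1/p-2}}`. -/
def TpOp (p : ℝ) (g : ℂ → ℂ) : ℂ → ℂ :=
  fun z => ∑' k : ℕ,
    taylorCoeff g k * ((momentW (nuWeight (1 / p - 2)) (2 * (k:ℝ) + 1) : ℝ) : ℂ) * z ^ k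

/-- Membership in the Bloch space. -/
def InBloch (g : ℂ → ℂ) : Prop :=
  DifferentiableOn ℂ g (Metric.ball 0 1) ∧ BlochNormE g < ⊤

open Classical in
/-- The norm of the space `X_p = T_p(B)`, normed so that `T_p` is an isometry. -/
def XpNormE (p : ℝ) (h : ℂ → ℂ) : ℝ≥0∞ :=
  if H : ∃ g : ℂ → ℂ, InBloch g ∧ Set.EqOn h (TpOp p g) (Metric.ball 0 1)
  then BlochNormE H.choose else ⊤

/-- The polynomial `V_n ∗ g` where `V_n(z) = ∑_{j=2^{n-1}}^{2^{n+1}-1} ψ(j/2^{n-1}) z^j`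
and `ψ(t) = Ψ(t/2) - Ψ(t)`. -/
def VnStar (Ψ : ℝ → ℝ) (n : ℕ) (g : ℂ → ℂ) : ℂ → ℂ :=
  fun z => ∑ j ∈ Finset.Icc (2 ^ (n - 1) : ℕ) (2 ^ (n + 1) - 1 : ℕ),
    (((Ψ ((j:ℝ) / 2 ^ n) - Ψ ((j:ℝ) / 2 ^ (n - 1))) : ℝ) : ℂ) * taylorCoeff g j * z ^ j

/-- `D^ω(V_n ∗ g)`, where `D^ω h(z) = ∑ ĥ(k) z^k/(2ω_{2k+1})`. -/
def DVnStar (Ψ : ℝ → ℝ) (ω : ℝ → ℝ) (n : ℕ) (g : ℂ → ℂ) : ℂ → ℂ :=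
  fun z => ∑ j ∈ Finset.Icc (2 ^ (n - 1) : ℕ) (2 ^ (n + 1) - 1 : ℕ),
    (((Ψ ((j:ℝ) / 2 ^ n) - Ψ ((j:ℝ) / 2 ^ (n - 1))) : ℝ) : ℂ) * taylorCoeff g j * z ^ j /
      (2 * ((momentW ω (2 * (j:ℝ) + 1) : ℝ) : ℂ))

/-- `J_ω(t) = ∫_0^t ds/(ω̂(s)(1-s))`. -/
def Jomega (ω : ℝ → ℝ) (t : ℝ) : ℝ := ∫ s in (0:ℝ)..t, 1 / (omegaHat ω s * (1 - s))

/-- Normalized arc length measure on the parameter interval `(0, 2π)`. -/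
def circMeas : Measure ℝ :=
  ENNReal.ofReal (1 / (2 * Real.pi)) • volume.restrict (Ioo (0:ℝ) (2 * Real.pi))

instance circMeas_isProbabilityMeasure : IsProbabilityMeasure circMeas := by
  constructor
  have h : (0:ℝ) < 2 * Real.pi := Real.two_pi_pos
  simp only [circMeas, Measure.smul_apply, Measure.restrict_apply_univ, Real.volume_Ioo, sub_zero,
    smul_eq_mul]
  rw [← ENNReal.ofReal_mul (by positivity), one_div, inv_mul_cancel₀ h.ne', ENNReal.ofReal_one]

theorem integral_circMeas {F : Type*} [NormedAddCommGroup F] [NormedSpace ℝ F] (φ : ℝ → F) :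
    ∫ θ, φ θ ∂circMeas = (2 * Real.pi)⁻¹ • ∫ θ in (0:ℝ)..(2 * Real.pi), φ θ := by
  rw [circMeas, integral_smul_measure, intervalIntegral.integral_of_le Real.two_pi_pos.le,
    integral_Ioc_eq_integral_Ioo, ENNReal.toReal_ofReal (by positivity), one_div]

theorem memLp_circMeas {F : Type*} [NormedAddCommGroup F] {φ : ℝ → F} (hφ : Continuous φ)
    (p : ℝ≥0∞) : MemLp φ p circMeas := by
  obtain ⟨C, hC⟩ := (isCompact_Icc (a := (0:ℝ)) (b := 2 * Real.pi)).exists_bound_of_continuousOn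
    hφ.continuousOn
  have hm : AEStronglyMeasurable φ circMeas :=
    (hφ.aestronglyMeasurable (μ := volume.restrict (Ioo (0:ℝ) (2 * Real.pi)))).smul_measure _
  refine MemLp.of_bound hm C ?_
  refine Measure.ae_smul_measure ?_ _
  filter_upwards [ae_restrict_mem measurableSet_Ioo] with θ hθ
  exact hC θ ⟨hθ.1.le, hθ.2.le⟩

theorem integrable_circMeas {F : Type*} [NormedAddCommGroup F] {φ : ℝ → F} (hφ : Continuous φ) :
    Integrable φ circMeas :=
  memLp_one_iff_integrable.1 (memLp_circMeas hφ 1)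

/-- The `L^p` norm over the circle of a function of the angle. -/
def cnorm (p : ℝ) (φ : ℝ → ℂ) : ℝ := (eLpNorm φ (ENNReal.ofReal p) circMeas).toReal

theorem MpE_eq_eLpNorm {p : ℝ} (hp : 0 < p) (r : ℝ) (f : ℂ → ℂ) :
    MpE p r f = eLpNorm (fun θ => f (circlePt r θ)) (ENNReal.ofReal p) circMeas := by
  rw [eLpNorm_eq_lintegral_rpow_enorm_toReal (by simpa using hp) ENNReal.ofReal_ne_top,
    ENNReal.toReal_ofReal hp.le, MpE, circMeas, lintegral_smul_measure, smul_eq_mul]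
  congr 3
  funext θ
  rw [← ofReal_norm, ENNReal.ofReal_rpow_of_nonneg (norm_nonneg _) hp.le]

theorem cnorm_nonneg (p : ℝ) (φ : ℝ → ℂ) : 0 ≤ cnorm p φ := ENNReal.toReal_nonneg

theorem ofReal_cnorm {φ : ℝ → ℂ} (hφ : Continuous φ) (p : ℝ) :
    ENNReal.ofReal (cnorm p φ) = eLpNorm φ (ENNReal.ofReal p) circMeas :=
  ENNReal.ofReal_toReal (memLp_circMeas hφ _).2.ne

theorem cnorm_rpow {p : ℝ} (hp : 0 < p) {φ : ℝ → ℂ} (hφ : Continuous φ) :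
    cnorm p φ ^ p = ∫ θ, ‖φ θ‖ ^ p ∂circMeas := by
  have h0 : 0 ≤ ∫ θ, ‖φ θ‖ ^ p ∂circMeas :=
    integral_nonneg fun θ => Real.rpow_nonneg (norm_nonneg _) _
  rw [cnorm, (memLp_circMeas hφ _).eLpNorm_eq_integral_rpow_norm (by simpa using hp)
    ENNReal.ofReal_ne_top, ENNReal.toReal_ofReal hp.le,
    ENNReal.toReal_ofReal (Real.rpow_nonneg h0 _), ← Real.rpow_mul h0, inv_mul_cancel₀ hp.ne',
    Real.rpow_one]

theorem cnorm_eq {p : ℝ} (hp : 0 < p) {φ : ℝ → ℂ} (hφ : Continuous φ) :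
    cnorm p φ = (∫ θ, ‖φ θ‖ ^ p ∂circMeas) ^ (1 / p) := by
  rw [← cnorm_rpow hp hφ, ← Real.rpow_mul (cnorm_nonneg _ _), mul_one_div_cancel hp.ne',
    Real.rpow_one]

theorem cnorm_add_le {p : ℝ} (hp : 1 ≤ p) {φ ψ : ℝ → ℂ} (hφ : Continuous φ) (hψ : Continuous ψ) :
    cnorm p (fun θ => φ θ + ψ θ) ≤ cnorm p φ + cnorm p ψ := by
  have := eLpNorm_add_le (memLp_circMeas hφ (ENNReal.ofReal p)).1
    (memLp_circMeas hψ (ENNReal.ofReal p)).1 (ENNReal.one_le_ofReal.2 hp)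
  rw [cnorm, cnorm, cnorm, ← ENNReal.toReal_add (memLp_circMeas hφ _).2.ne
    (memLp_circMeas hψ _).2.ne]
  exact ENNReal.toReal_mono (ENNReal.add_ne_top.2 ⟨(memLp_circMeas hφ _).2.ne,
    (memLp_circMeas hψ _).2.ne⟩) this

theorem cnorm_const_mul (p : ℝ) (c : ℂ) (φ : ℝ → ℂ) :
    cnorm p (fun θ => c * φ θ) = ‖c‖ * cnorm p φ := by
  have := eLpNorm_const_smul c φ (ENNReal.ofReal p) circMeas
  rw [cnorm, cnorm]
  change (eLpNorm (c • φ) _ _).toReal = _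
  rw [this, ENNReal.toReal_mul, toReal_enorm]

theorem cnorm_sum_le {p : ℝ} (hp : 1 ≤ p) {ι : Type*} (s : Finset ι) (φ : ι → ℝ → ℂ)
    (hφ : ∀ i ∈ s, Continuous (φ i)) :
    cnorm p (fun θ => ∑ i ∈ s, φ i θ) ≤ ∑ i ∈ s, cnorm p (φ i) := by
  classical
  induction s using Finset.induction_on with
  | empty =>
    simp only [Finset.sum_empty, cnorm]
    have : eLpNorm (fun _ : ℝ => (0:ℂ)) (ENNReal.ofReal p) circMeas = 0 := eLpNorm_zero
    simp [this]
  | insert i s hi ih =>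
    simp only [Finset.sum_insert hi]
    refine (cnorm_add_le hp (hφ i (by simp)) (continuous_finsetSum s fun j hj =>
      hφ j (by simp [hj]))).trans ?_
    gcongr
    exact ih fun j hj => hφ j (by simp [hj])

theorem cnorm_mono (p : ℝ) {φ ψ : ℝ → ℂ} (hψ : Continuous ψ)
    (h : ∀ θ, ‖φ θ‖ ≤ ‖ψ θ‖) : cnorm p φ ≤ cnorm p ψ :=
  ENNReal.toReal_mono (memLp_circMeas hψ _).2.ne (eLpNorm_mono h)

theorem cnorm_le_of_bound {p : ℝ} {φ : ℝ → ℂ} {B : ℝ}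
    (h : ∀ θ, ‖φ θ‖ ≤ B) : cnorm p φ ≤ B := by
  have hB : 0 ≤ B := (norm_nonneg _).trans (h 0)
  have := eLpNorm_le_of_ae_bound (p := ENNReal.ofReal p) (μ := circMeas) (.of_forall h)
  simp only [measure_univ, ENNReal.one_rpow, one_mul] at this
  refine ENNReal.toReal_le_of_le_ofReal hB this

theorem cnorm_congr_norm (p : ℝ) {φ ψ : ℝ → ℂ} (h : ∀ θ, ‖φ θ‖ = ‖ψ θ‖) :
    cnorm p φ = cnorm p ψ := by
  rw [cnorm, cnorm, eLpNorm_congr_norm_ae (.of_forall h)]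

theorem norm_integral_mul_le_cnorm {p p' : ℝ} (hpp : p.HolderConjugate p') {φ ψ : ℝ → ℂ}
    (hφ : Continuous φ) (hψ : Continuous ψ) :
    ‖∫ θ, φ θ * ψ θ ∂circMeas‖ ≤ cnorm p φ * cnorm p' ψ := by
  refine (norm_integral_le_integral_norm _).trans ?_
  simp only [norm_mul]
  rw [cnorm_eq hpp.pos hφ, cnorm_eq hpp.symm.pos hψ]
  exact integral_mul_norm_le_Lp_mul_Lq hpp (memLp_circMeas hφ _) (memLp_circMeas hψ _)

theorem norm_integral_le_cnorm {p : ℝ} (hp : 1 ≤ p) {φ : ℝ → ℂ} (hφ : Continuous φ) :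
    ‖∫ θ, φ θ ∂circMeas‖ ≤ cnorm p φ := by
  refine (norm_integral_le_integral_norm _).trans ?_
  have h1 := eLpNorm_le_eLpNorm_of_exponent_le (μ := circMeas) (p := 1) (q := ENNReal.ofReal p)
    (by simpa using hp) (memLp_circMeas hφ 1).1
  have h2 := ENNReal.toReal_mono (memLp_circMeas hφ _).2.ne h1
  rwa [eLpNorm_one_eq_lintegral_enorm, ← integral_norm_eq_lintegral_enorm
    (memLp_circMeas hφ 1).1] at h2

/-- The element `|φ|^{p-2} φ` dual to `φ ∈ L^p`. -/
def dualElt (p : ℝ) (z : ℂ) : ℂ := ((‖z‖ ^ (p - 2) : ℝ) : ℂ) * z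

theorem norm_dualElt {p : ℝ} (hp : 1 < p) (z : ℂ) : ‖dualElt p z‖ = ‖z‖ ^ (p - 1) := by
  rw [dualElt, norm_mul, Complex.norm_real, Real.norm_of_nonneg (Real.rpow_nonneg (norm_nonneg _) _)]
  rcases eq_or_ne z 0 with rfl | hz
  · simp [Real.zero_rpow (by linarith : p - 1 ≠ 0)]
  · have h : 0 < ‖z‖ := norm_pos_iff.2 hz
    rw [show p - 1 = (p - 2) + 1 by ring, Real.rpow_add_one h.ne']

theorem continuous_dualElt {p : ℝ} (hp : 1 < p) : Continuous (dualElt p) := by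
  rw [continuous_iff_continuousAt]
  intro z
  rcases eq_or_ne z 0 with rfl | hz
  · have h0 : dualElt p 0 = 0 := by simp [dualElt]
    rw [ContinuousAt, h0, tendsto_zero_iff_norm_tendsto_zero]
    simp only [norm_dualElt hp]
    have : ContinuousAt (fun z : ℂ => ‖z‖ ^ (p - 1)) 0 :=
      continuous_norm.continuousAt.rpow_const (Or.inr (by linarith))
    simpa [ContinuousAt, Real.zero_rpow (by linarith : p - 1 ≠ 0)] using this
  · unfold dualElt
    have : ContinuousAt (fun z : ℂ => ‖z‖ ^ (p - 2)) z :=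
      continuous_norm.continuousAt.rpow_const (Or.inl (norm_ne_zero_iff.2 hz))
    exact (Complex.continuous_ofReal.continuousAt.comp this).mul continuousAt_id

theorem mul_conj_dualElt {p : ℝ} (hp : 1 < p) (z : ℂ) :
    z * (starRingEnd ℂ) (dualElt p z) = ((‖z‖ ^ p : ℝ) : ℂ) := by
  rw [dualElt, map_mul, Complex.conj_ofReal, mul_left_comm, Complex.mul_conj,
    Complex.normSq_eq_norm_sq, ← Complex.ofReal_mul]
  congr 1
  rcases eq_or_ne z 0 with rfl | hz
  · simp [Real.zero_rpow (by linarith : p ≠ 0)]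
  · have h : 0 < ‖z‖ := norm_pos_iff.2 hz
    rw [← Real.rpow_natCast, ← Real.rpow_add h]
    norm_num

theorem cnorm_dualElt {p p' : ℝ} (hpp : p.HolderConjugate p') {φ : ℝ → ℂ} (hφ : Continuous φ) :
    cnorm p' (fun θ => dualElt p (φ θ)) = cnorm p φ ^ (p - 1) := by
  have hc : Continuous fun θ => dualElt p (φ θ) := (continuous_dualElt hpp.lt).comp hφ
  rw [cnorm_eq hpp.symm.pos hc]
  simp only [norm_dualElt hpp.lt]
  have : ∀ θ, (‖φ θ‖ ^ (p - 1)) ^ p' = ‖φ θ‖ ^ p := fun θ => by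
    rw [← Real.rpow_mul (norm_nonneg _), hpp.sub_one_mul_conj]
  simp only [this]
  have he : p * (1 / p') = p - 1 := by
    rw [mul_one_div, div_eq_iff hpp.symm.ne_zero, hpp.sub_one_mul_conj]
  rw [← cnorm_rpow hpp.pos hφ, ← Real.rpow_mul (cnorm_nonneg _ _), he]

theorem cnorm_le_of_dualElt {p : ℝ} (hp : 1 < p) {φ : ℝ → ℂ} (hφ : Continuous φ) {K : ℝ}
    (hK : 0 ≤ K)
    (h : ‖∫ θ, φ θ * (starRingEnd ℂ) (dualElt p (φ θ)) ∂circMeas‖ ≤ K * cnorm p φ ^ (p - 1)) :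
    cnorm p φ ≤ K := by
  simp only [mul_conj_dualElt hp] at h
  rw [integral_complex_ofReal, ← cnorm_rpow (by linarith) hφ, Complex.norm_real,
    Real.norm_of_nonneg (Real.rpow_nonneg (cnorm_nonneg _ _) _)] at h
  rcases (cnorm_nonneg p φ).eq_or_lt with h0 | h0
  · rwa [← h0]
  · have he : cnorm p φ ^ p = cnorm p φ ^ (p - 1) * cnorm p φ := by
      rw [← Real.rpow_add_one h0.ne', sub_add_cancel]
    rw [he, mul_comm] at h
    exact le_of_mul_le_mul_right h (Real.rpow_pos_of_pos h0 _)

/-- The trigonometric polynomial `∑ c_n e^{inθ}`. -/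
def trigEval (c : ℤ →₀ ℂ) : ℝ → ℂ :=
  Finsupp.linearCombination ℂ (fun (n : ℤ) (θ : ℝ) => Complex.exp ((n:ℂ) * θ * Complex.I)) c

theorem trigEval_apply (c : ℤ →₀ ℂ) (θ : ℝ) :
    trigEval c θ = ∑ n ∈ c.support, c n * Complex.exp ((n:ℂ) * θ * Complex.I) := by
  simp [trigEval, Finsupp.linearCombination_apply, Finsupp.sum, Finset.sum_apply]

theorem trigEval_add (c d : ℤ →₀ ℂ) (θ : ℝ) :
    trigEval (c + d) θ = trigEval c θ + trigEval d θ := by simp [trigEval]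

theorem trigEval_smul (a : ℂ) (c : ℤ →₀ ℂ) (θ : ℝ) :
    trigEval (a • c) θ = a * trigEval c θ := by simp [trigEval]

theorem trigEval_single (n : ℤ) (a : ℂ) (θ : ℝ) :
    trigEval (Finsupp.single n a) θ = a * Complex.exp ((n:ℂ) * θ * Complex.I) := by
  simp [trigEval]

theorem continuous_trigEval (c : ℤ →₀ ℂ) : Continuous (trigEval c) := by
  have : trigEval c = fun θ : ℝ => ∑ n ∈ c.support, c n * Complex.exp ((n:ℂ) * θ * Complex.I) :=
    funext (trigEval_apply c)
  rw [this]
  fun_prop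

theorem exists_trigEval_conj (c : ℤ →₀ ℂ) :
    ∃ d : ℤ →₀ ℂ, ∀ θ, trigEval d θ = (starRingEnd ℂ) (trigEval c θ) := by
  induction c using Finsupp.induction_linear with
  | zero => exact ⟨0, fun θ => by simp [trigEval]⟩
  | add c c' h h' =>
    obtain ⟨d, hd⟩ := h
    obtain ⟨d', hd'⟩ := h'
    exact ⟨d + d', fun θ => by rw [trigEval_add, trigEval_add, hd, hd', map_add]⟩
  | single n a =>
    refine ⟨Finsupp.single (-n) ((starRingEnd ℂ) a), fun θ => ?_⟩
    rw [trigEval_single, trigEval_single, map_mul, ← Complex.exp_conj]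
    congr 2
    simp

/-- A trigonometric polynomial with strictly positive values. -/
def IsPosTrig (c : ℤ →₀ ℂ) : Prop := ∀ θ, ∃ t : ℝ, 0 < t ∧ trigEval c θ = (t : ℂ)

theorem exists_posTrig_approx {ψ : ℝ → ℝ} (hψ : Continuous ψ)
    (hper : Function.Periodic ψ (2 * Real.pi)) (h0 : ∀ θ, 0 ≤ ψ θ) {ε : ℝ} (hε : 0 < ε) :
    ∃ c, IsPosTrig c ∧ ∀ θ, ‖trigEval c θ - (ψ θ : ℂ)‖ ≤ ε := by
  have : Fact (0 < 2 * Real.pi) := ⟨Real.two_pi_pos⟩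
  have hper' : Function.Periodic (fun θ => ((ψ θ + ε / 2 : ℝ) : ℂ)) (2 * Real.pi) := fun θ => by
    simp [hper θ]
  have hcont : Continuous hper'.lift := by
    refine continuous_coinduced_dom.2 ?_
    change Continuous fun θ : ℝ => ((ψ θ + ε / 2 : ℝ) : ℂ)
    fun_prop
  let F : C(AddCircle (2 * Real.pi), ℂ) := ⟨hper'.lift, hcont⟩
  have hF : F ∈ (Submodule.span ℂ (range (@fourier (2 * Real.pi)))).topologicalClosure := by
    rw [span_fourier_closure_eq_top]; trivial
  obtain ⟨G, hG, hFG⟩ := Metric.mem_closure_iff.1 hF (ε / 2) (by positivity)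
  obtain ⟨c, rfl⟩ := Finsupp.mem_span_range_iff_exists_finsupp.1 hG
  have hval : ∀ θ : ℝ, (c.sum fun i a => a • fourier (T := 2 * Real.pi) i) (θ : AddCircle (2 * Real.pi))
      = trigEval c θ := by
    intro θ
    rw [trigEval_apply, Finsupp.sum, ContinuousMap.sum_apply]
    refine Finset.sum_congr rfl fun n _ => ?_
    rw [ContinuousMap.smul_apply, fourier_coe_apply, smul_eq_mul]
    congr 2
    have : (Real.pi : ℂ) ≠ 0 := by exact_mod_cast Real.pi_ne_zero
    push_cast
    field_simp
  have hb : ∀ θ : ℝ, ‖trigEval c θ - ((ψ θ + ε / 2 : ℝ) : ℂ)‖ < ε / 2 := by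
    intro θ
    rw [← hval θ, ← dist_eq_norm, dist_comm]
    exact (ContinuousMap.dist_apply_le_dist (f := F) (θ : AddCircle (2 * Real.pi))).trans_lt hFG
  obtain ⟨d, hd⟩ := exists_trigEval_conj c
  have hre : ∀ θ, trigEval ((1 / 2 : ℂ) • (c + d)) θ = ((trigEval c θ).re : ℂ) := fun θ => by
    rw [trigEval_smul, trigEval_add, hd, Complex.add_conj]
    push_cast; ring
  have hb' : ∀ θ, |(trigEval c θ).re - (ψ θ + ε / 2)| < ε / 2 := fun θ => by
    have h1 := (Complex.abs_re_le_norm _).trans_lt (hb θ)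
    simpa using h1
  refine ⟨(1 / 2 : ℂ) • (c + d), fun θ => ⟨_, ?_, hre θ⟩, fun θ => ?_⟩
  · have := (abs_lt.1 (hb' θ)).1
    linarith [h0 θ]
  · rw [hre, ← Complex.ofReal_sub, Complex.norm_real, Real.norm_eq_abs, abs_le]
    have := abs_lt.1 (hb' θ)
    constructor <;> linarith

theorem norm_integral_mul_le_of_posTrig {p' : ℝ} (hp' : 1 ≤ p') {φ : ℝ → ℂ} (hφ : Continuous φ)
    {K : ℝ} (hK : 0 ≤ K)
    (h : ∀ c, IsPosTrig c →
      ‖∫ θ, φ θ * (starRingEnd ℂ) (trigEval c θ) ∂circMeas‖ ≤ K * cnorm p' (trigEval c))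
    {ψ : ℝ → ℝ} (hψ : Continuous ψ)
    (hper : Function.Periodic ψ (2 * Real.pi)) (h0 : ∀ θ, 0 ≤ ψ θ) :
    ‖∫ θ, φ θ * (ψ θ : ℂ) ∂circMeas‖ ≤ K * cnorm p' (fun θ => (ψ θ : ℂ)) := by
  have hψ' : Continuous fun θ => (ψ θ : ℂ) := Complex.continuous_ofReal.comp hψ
  set B := ∫ θ, ‖φ θ‖ ∂circMeas
  refine le_of_forall_pos_le_add fun δ hδ => ?_
  have hB : 0 ≤ B := integral_nonneg fun θ => norm_nonneg _
  obtain ⟨ε, hε, hεδ⟩ : ∃ ε : ℝ, 0 < ε ∧ ε * (B + K) ≤ δ := by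
    refine ⟨δ / (B + K + 1), by positivity, ?_⟩
    rw [div_mul_eq_mul_div, div_le_iff₀ (by positivity)]
    nlinarith
  obtain ⟨c, hc, hcε⟩ := exists_posTrig_approx hψ hper h0 hε
  have hcc := continuous_trigEval c
  have h1 := h c hc
  have hconj : ∀ θ, (starRingEnd ℂ) (trigEval c θ) = trigEval c θ := fun θ => by
    obtain ⟨t, -, ht⟩ := hc θ
    rw [ht, Complex.conj_ofReal]
  simp only [hconj] at h1
  have h2 : cnorm p' (trigEval c) ≤ cnorm p' (fun θ => (ψ θ : ℂ)) + ε := by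
    have := cnorm_add_le hp' hψ' (hcc.sub hψ')
    simp only [Pi.sub_apply, add_sub_cancel] at this
    refine this.trans ?_
    gcongr
    exact cnorm_le_of_bound hcε
  have h3 : ‖∫ θ, φ θ * ((ψ θ : ℂ) - trigEval c θ) ∂circMeas‖ ≤ ε * B := by
    rw [mul_comm, ← integral_mul_const]
    refine norm_integral_le_of_norm_le (integrable_circMeas (by fun_prop)) (.of_forall fun θ => ?_)
    rw [norm_mul, norm_sub_rev]
    gcongr
    exact hcε θ
  have h4 : ∫ θ, φ θ * (ψ θ : ℂ) ∂circMeas = ∫ θ, φ θ * trigEval c θ ∂circMeas +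
      ∫ θ, φ θ * ((ψ θ : ℂ) - trigEval c θ) ∂circMeas := by
    rw [← integral_add (integrable_circMeas (by fun_prop)) (integrable_circMeas (by fun_prop))]
    congr 1; funext θ; ring
  rw [h4]
  calc _ ≤ K * cnorm p' (trigEval c) + ε * B := (norm_add_le _ _).trans (add_le_add h1 h3)
    _ ≤ K * (cnorm p' (fun θ => (ψ θ : ℂ)) + ε) + ε * B := by gcongr
    _ ≤ _ := by linarith

/-- `L^p` norms over the circle are determined, up to a factor, by pairing with positive
trigonometric polynomials. -/
theorem cnorm_le_of_posTrig {p p' : ℝ} (hpp : p.HolderConjugate p') {φ : ℝ → ℂ}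
    (hφ : Continuous φ) (hper : Function.Periodic φ (2 * Real.pi)) {K : ℝ} (hK : 0 ≤ K)
    (h : ∀ c, IsPosTrig c →
      ‖∫ θ, φ θ * (starRingEnd ℂ) (trigEval c θ) ∂circMeas‖ ≤ K * cnorm p' (trigEval c)) :
    cnorm p φ ≤ 4 * K := by
  refine cnorm_le_of_dualElt hpp.lt hφ (by positivity) ?_
  set ψ : ℝ → ℂ := fun θ => dualElt p (φ θ) with hψdef
  have hψ : Continuous ψ := (continuous_dualElt hpp.lt).comp hφ
  have hψp : Function.Periodic ψ (2 * Real.pi) := fun θ => by simp [hψdef, hper θ]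
  have key : ∀ u : ℝ → ℝ, Continuous u → Function.Periodic u (2 * Real.pi) → (∀ θ, 0 ≤ u θ) →
      (∀ θ, u θ ≤ ‖ψ θ‖) → ‖∫ θ, φ θ * (u θ : ℂ) ∂circMeas‖ ≤ K * cnorm p φ ^ (p - 1) := by
    intro u hu hup hu0 hle
    refine (norm_integral_mul_le_of_posTrig hpp.symm.lt.le hφ hK h hu hup hu0).trans ?_
    rw [← cnorm_dualElt hpp hφ]
    gcongr
    refine cnorm_mono _ hψ fun θ => ?_
    rw [Complex.norm_real, Real.norm_of_nonneg (hu0 θ)]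
    exact hle θ
  have k1 := key (fun θ => max (ψ θ).re 0) (by fun_prop) (fun θ => by simp [hψp θ])
    (fun θ => le_max_right _ _)
    (fun θ => max_le (Complex.re_le_norm _) (norm_nonneg _))
  have k2 := key (fun θ => max (-(ψ θ).re) 0) (by fun_prop) (fun θ => by simp [hψp θ])
    (fun θ => le_max_right _ _)
    (fun θ => max_le ((neg_le_abs _).trans (Complex.abs_re_le_norm _)) (norm_nonneg _))
  have k3 := key (fun θ => max (ψ θ).im 0) (by fun_prop) (fun θ => by simp [hψp θ])
    (fun θ => le_max_right _ _)
    (fun θ => max_le ((le_abs_self _).trans (Complex.abs_im_le_norm _)) (norm_nonneg _))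
  have k4 := key (fun θ => max (-(ψ θ).im) 0) (by fun_prop) (fun θ => by simp [hψp θ])
    (fun θ => le_max_right _ _)
    (fun θ => max_le ((neg_le_abs _).trans (Complex.abs_im_le_norm _)) (norm_nonneg _))
  have hdec : ∀ θ, φ θ * (starRingEnd ℂ) (ψ θ) =
      φ θ * ((max (ψ θ).re 0 : ℝ) : ℂ) - φ θ * ((max (-(ψ θ).re) 0 : ℝ) : ℂ) -
      Complex.I * (φ θ * ((max (ψ θ).im 0 : ℝ) : ℂ)) +
      Complex.I * (φ θ * ((max (-(ψ θ).im) 0 : ℝ) : ℂ)) := by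
    intro θ
    have e : ∀ x : ℝ, max x 0 - max (-x) 0 = x := fun x => by
      rcases le_total x 0 with hx | hx
      · rw [max_eq_right hx, max_eq_left (by linarith)]; ring
      · rw [max_eq_left hx, max_eq_right (by linarith)]; ring
    have e1 := congrArg (fun x : ℝ => (x : ℂ)) (e (ψ θ).re)
    have e2 := congrArg (fun x : ℝ => (x : ℂ)) (e (ψ θ).im)
    simp only [Complex.ofReal_sub] at e1 e2
    have e3 : (starRingEnd ℂ) (ψ θ) = ((ψ θ).re : ℂ) - Complex.I * ((ψ θ).im : ℂ) := by
      apply Complex.ext <;> simp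
    rw [e3, ← e1, ← e2]
    ring
  have hi : ∀ u : ℝ → ℝ, Continuous u → Integrable (fun θ => φ θ * (u θ : ℂ)) circMeas :=
    fun u hu => integrable_circMeas (by fun_prop)
  change ‖∫ θ, φ θ * (starRingEnd ℂ) (ψ θ) ∂circMeas‖ ≤ _
  simp only [hdec]
  have i1 := hi (fun θ => max (ψ θ).re 0) (by fun_prop)
  have i2 := hi (fun θ => max (-(ψ θ).re) 0) (by fun_prop)
  have i3 := hi (fun θ => max (ψ θ).im 0) (by fun_prop)
  have i4 := hi (fun θ => max (-(ψ θ).im) 0) (by fun_prop)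
  have hsum := integral_add ((i1.sub i2).sub (i3.const_mul Complex.I)) (i4.const_mul Complex.I)
  rw [integral_sub' (i1.sub i2) (i3.const_mul _), integral_sub' i1 i2, integral_const_mul,
    integral_const_mul] at hsum
  refine (congrArg norm hsum).le.trans ?_
  refine (norm_add_le _ _).trans ?_
  refine (add_le_add ((norm_sub_le _ _).trans (add_le_add (norm_sub_le _ _) le_rfl)) le_rfl).trans ?_
  simp only [norm_mul, Complex.norm_I, one_mul]
  linarith

theorem integral_exp_circMeas (n : ℤ) :
    ∫ θ : ℝ, Complex.exp ((n:ℂ) * θ * Complex.I) ∂circMeas = if n = 0 then 1 else 0 := by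
  split_ifs with h
  · subst h; simp
  · rw [integral_circMeas]
    have hc : (n:ℂ) * Complex.I ≠ 0 :=
      mul_ne_zero (by exact_mod_cast h) Complex.I_ne_zero
    have : ∀ θ : ℝ, Complex.exp ((n:ℂ) * θ * Complex.I) = Complex.exp (((n:ℂ) * Complex.I) * θ) :=
      fun θ => by congr 1; ring
    simp only [this]
    rw [integral_exp_mul_complex hc]
    have h2 : (n:ℂ) * Complex.I * ((2 * Real.pi : ℝ) : ℂ) = n * (2 * Real.pi * Complex.I) := by
      push_cast; ring
    rw [h2, Complex.exp_int_mul_two_pi_mul_I]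
    simp

theorem integral_exp_mul_conj_exp (n m : ℤ) :
    ∫ θ : ℝ, Complex.exp ((n:ℂ) * θ * Complex.I) *
      (starRingEnd ℂ) (Complex.exp ((m:ℂ) * θ * Complex.I)) ∂circMeas = if n = m then 1 else 0 := by
  have : ∀ θ : ℝ, Complex.exp ((n:ℂ) * θ * Complex.I) *
      (starRingEnd ℂ) (Complex.exp ((m:ℂ) * θ * Complex.I)) =
      Complex.exp (((n - m : ℤ) : ℂ) * θ * Complex.I) := fun θ => by
    rw [← Complex.exp_conj, ← Complex.exp_add]
    congr 1
    simp
    ring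
  simp only [this, integral_exp_circMeas, sub_eq_zero]

theorem integral_trigEval_mul_conj_exp (c : ℤ →₀ ℂ) (m : ℤ) :
    ∫ θ : ℝ, trigEval c θ * (starRingEnd ℂ) (Complex.exp ((m:ℂ) * θ * Complex.I)) ∂circMeas
      = c m := by
  simp only [trigEval_apply, Finset.sum_mul]
  rw [integral_finsetSum _ fun n _ => integrable_circMeas (by fun_prop)]
  simp only [mul_assoc, integral_const_mul]
  simp only [← mul_assoc, integral_exp_mul_conj_exp]
  simp only [mul_ite, mul_one, mul_zero, Finset.sum_ite_eq', Finsupp.mem_support_iff]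
  split_ifs with h
  · rfl
  · exact (not_not.1 h).symm

theorem integral_mul_conj_trigEval {φ : ℝ → ℂ} (hφ : Continuous φ) (d : ℤ →₀ ℂ) :
    ∫ θ : ℝ, φ θ * (starRingEnd ℂ) (trigEval d θ) ∂circMeas
      = ∑ n ∈ d.support, (starRingEnd ℂ) (d n) *
        ∫ θ : ℝ, φ θ * (starRingEnd ℂ) (Complex.exp ((n:ℂ) * θ * Complex.I)) ∂circMeas := by
  simp only [trigEval_apply, map_sum, map_mul, Finset.mul_sum]
  rw [integral_finsetSum _ fun n _ => integrable_circMeas (by fun_prop)]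
  refine Finset.sum_congr rfl fun n _ => ?_
  rw [← integral_const_mul]
  congr 1; funext θ; ring

theorem integral_trigEval_mul_conj_trigEval (c d : ℤ →₀ ℂ) :
    ∫ θ : ℝ, trigEval c θ * (starRingEnd ℂ) (trigEval d θ) ∂circMeas
      = ∑ n ∈ d.support, (starRingEnd ℂ) (d n) * c n := by
  rw [integral_mul_conj_trigEval (continuous_trigEval c)]
  simp only [integral_trigEval_mul_conj_exp]

theorem periodic_trigEval (c : ℤ →₀ ℂ) : Function.Periodic (trigEval c) (2 * Real.pi) := by
  intro θ
  rw [trigEval_apply, trigEval_apply]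
  refine Finset.sum_congr rfl fun n _ => ?_
  congr 1
  rw [Complex.exp_eq_exp_iff_exists_int]
  exact ⟨n, by push_cast; ring⟩

/-- The spectral projection onto frequencies at least `N`. -/
def freqProj (N : ℤ) (c : ℤ →₀ ℂ) : ℤ →₀ ℂ := c.filter (N ≤ ·)

theorem freqProj_apply (N : ℤ) (c : ℤ →₀ ℂ) (n : ℤ) :
    freqProj N c n = if N ≤ n then c n else 0 := by
  rw [freqProj, Finsupp.filter_apply]

theorem integral_freqProj_symm (N : ℤ) (c d : ℤ →₀ ℂ) :
    ∫ θ : ℝ, trigEval (freqProj N c) θ * (starRingEnd ℂ) (trigEval d θ) ∂circMeas =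
    ∫ θ : ℝ, trigEval c θ * (starRingEnd ℂ) (trigEval (freqProj N d) θ) ∂circMeas := by
  rw [integral_trigEval_mul_conj_trigEval, integral_trigEval_mul_conj_trigEval]
  rw [Finset.sum_subset (s₁ := (freqProj N d).support) (s₂ := d.support)]
  · refine Finset.sum_congr rfl fun n _ => ?_
    rw [freqProj_apply, freqProj_apply]
    split_ifs <;> simp
  · rw [freqProj, Finsupp.support_filter]; exact Finset.filter_subset _ _
  · intro n _ hn
    simp [Finsupp.notMem_support_iff.1 hn]

theorem trigEval_eq_two_re {c : ℤ →₀ ℂ}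
    (hreal : ∀ θ, (starRingEnd ℂ) (trigEval c θ) = trigEval c θ) (θ : ℝ) :
    trigEval c θ = trigEval (freqProj 0 c) θ +
      (starRingEnd ℂ) (trigEval (freqProj 0 c) θ) - c 0 := by
  have hneg : ∀ (a : ℤ →₀ ℂ) (n : ℤ), ∫ θ : ℝ, (starRingEnd ℂ) (trigEval a θ) *
      (starRingEnd ℂ) (Complex.exp ((n:ℂ) * θ * Complex.I)) ∂circMeas =
      (starRingEnd ℂ) (a (-n)) := by
    intro a n
    rw [← integral_trigEval_mul_conj_exp, ← integral_conj]
    congr 1; funext θ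
    rw [map_mul, ← Complex.exp_conj, ← Complex.exp_conj]
    congr 2
    simp only [← Complex.exp_conj]
    congr 1
    simp
  have hsym : ∀ n, (starRingEnd ℂ) (c (-n)) = c n := fun n => by
    rw [← hneg, ← integral_trigEval_mul_conj_exp]
    simp only [hreal]
  obtain ⟨d, hd⟩ := exists_trigEval_conj (freqProj 0 c)
  have hdn : ∀ n, d n = (starRingEnd ℂ) (freqProj 0 c (-n)) := fun n => by
    rw [← hneg, ← integral_trigEval_mul_conj_exp]
    simp only [hd]
  have key : c = freqProj 0 c + d + (-1 : ℂ) • Finsupp.single 0 (c 0) := by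
    ext n
    simp only [Finsupp.add_apply, Finsupp.smul_apply, hdn, freqProj_apply, smul_eq_mul,
      Finsupp.single_apply]
    have h0 := hsym 0
    rw [neg_zero] at h0
    rcases lt_trichotomy n 0 with h | h | h
    · rw [if_neg (by omega), if_pos (by omega), if_neg (by omega), hsym]; simp
    · subst h; simp [h0]
    · rw [if_pos h.le, if_neg (by omega), if_neg (by omega)]; simp
  calc trigEval c θ = trigEval (freqProj 0 c + d + (-1 : ℂ) • Finsupp.single 0 (c 0)) θ := by
        rw [← key]
    _ = _ := by
        rw [trigEval_add, trigEval_add, hd, trigEval_smul, trigEval_single]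
        simp
        ring

theorem exists_angle_ineq {p : ℝ} (hp : 1 < p) (hp2 : p ≤ 2) :
    ∃ A B : ℝ, 0 ≤ A ∧ 0 ≤ B ∧ ∀ w : ℂ, 0 < w.re →
      ‖w‖ ^ p ≤ A * w.re ^ p - B * (w ^ (p : ℂ)).re := by
  have hpi := Real.pi_pos
  set α₀ := Real.pi * (p + 1) / (4 * p) with hα₀
  have hpα : p * α₀ = Real.pi * (p + 1) / 4 := by rw [hα₀]; field_simp
  have hα₀pos : 0 < α₀ := by positivity
  have hα₀lt : α₀ < Real.pi / 2 := by
    rw [hα₀, div_lt_div_iff₀ (by positivity) two_pos]; nlinarith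
  have hcos : Real.cos (p * α₀) < 0 := by
    apply Real.cos_neg_of_pi_div_two_lt_of_lt <;> rw [hpα] <;> nlinarith
  have hcos0 : 0 < Real.cos α₀ := Real.cos_pos_of_mem_Ioo ⟨by linarith, hα₀lt⟩
  set B := 1 / (-Real.cos (p * α₀)) with hB
  have hBpos : 0 < B := by
    have : 0 < -Real.cos (p * α₀) := by linarith
    positivity
  set A := (1 + B) / Real.cos α₀ ^ p with hA
  have hcp : 0 < Real.cos α₀ ^ p := Real.rpow_pos_of_pos hcos0 _
  refine ⟨A, B, by positivity, hBpos.le, fun w hw => ?_⟩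
  have hw0 : w ≠ 0 := by rintro rfl; simp at hw
  have hre : w.re = ‖w‖ * Real.cos (Complex.arg w) := (Complex.norm_mul_cos_arg w).symm
  have hcpos : 0 < Real.cos (Complex.arg w) := by
    rw [hre] at hw; exact (pos_iff_pos_of_mul_pos hw).1 (norm_pos_iff.2 hw0)
  have harg : |Complex.arg w| < Real.pi / 2 := Complex.abs_arg_lt_pi_div_two_iff.2 (Or.inl hw)
  rw [Complex.cpow_ofReal_re, hre, Real.mul_rpow (norm_nonneg _) hcpos.le]
  have hcosabs : Real.cos (Complex.arg w * p) = Real.cos (p * |Complex.arg w|) := by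
    rw [← Real.cos_abs, abs_mul, abs_of_pos (by linarith : 0 < p), mul_comm]
  have hcosabs' : Real.cos (Complex.arg w) = Real.cos |Complex.arg w| := (Real.cos_abs _).symm
  have key : 1 ≤ A * Real.cos (Complex.arg w) ^ p - B * Real.cos (Complex.arg w * p) := by
    rw [hcosabs]
    rcases le_total |Complex.arg w| α₀ with h | h
    · have h1 : Real.cos α₀ ≤ Real.cos (Complex.arg w) := by
        rw [hcosabs']
        exact Real.cos_le_cos_of_nonneg_of_le_pi (abs_nonneg _) (by linarith) h
      have h2 : Real.cos α₀ ^ p ≤ Real.cos (Complex.arg w) ^ p :=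
        Real.rpow_le_rpow hcos0.le h1 (by linarith)
      have h3 : 1 + B ≤ A * Real.cos (Complex.arg w) ^ p := by
        calc 1 + B = A * Real.cos α₀ ^ p := by rw [hA, div_mul_cancel₀ _ hcp.ne']
          _ ≤ _ := by gcongr
      nlinarith [Real.cos_le_one (p * |Complex.arg w|)]
    · have h1 : Real.cos (p * |Complex.arg w|) ≤ Real.cos (p * α₀) := by
        apply Real.cos_le_cos_of_nonneg_of_le_pi (by positivity)
        · nlinarith [abs_nonneg (Complex.arg w)]
        · gcongr
      have h2 : B * (-Real.cos (p * α₀)) = 1 := by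
        rw [hB, one_div, inv_mul_cancel₀ (by linarith)]
      have h3 : 0 ≤ A * Real.cos (Complex.arg w) ^ p := by positivity
      nlinarith
  have := mul_le_mul_of_nonneg_left key (Real.rpow_nonneg (norm_nonneg w) p)
  nlinarith [this]

theorem re_pos_of_re_pos_on_circle {F : ℂ → ℂ} (hF : Differentiable ℂ F)
    (h : ∀ z ∈ Metric.sphere (0:ℂ) 1, 0 < (F z).re) {z : ℂ} (hz : z ∈ Metric.closedBall (0:ℂ) 1) :
    0 < (F z).re := by
  have hcont : Continuous fun z => (F z).re := Complex.continuous_re.comp hF.continuous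
  obtain ⟨z₀, hz₀, hmin⟩ := (isCompact_sphere (0:ℂ) 1).exists_isMinOn
    (NormedSpace.sphere_nonempty.2 zero_le_one) hcont.continuousOn
  have hE : Differentiable ℂ fun z => Complex.exp (-F z) := hF.neg.cexp
  have := Complex.norm_le_of_forall_mem_frontier_norm_le (U := Metric.ball (0:ℂ) 1)
    (C := Real.exp (-(F z₀).re)) Metric.isBounded_ball hE.diffContOnCl
    (fun w hw => by
      rw [frontier_ball _ one_ne_zero] at hw
      rw [Complex.norm_exp, Complex.neg_re, Real.exp_le_exp, neg_le_neg_iff]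
      exact hmin hw) (by rwa [closure_ball _ one_ne_zero])
  rw [Complex.norm_exp, Complex.neg_re, Real.exp_le_exp, neg_le_neg_iff] at this
  exact (h z₀ hz₀).trans_le this

theorem integral_norm_rpow_le_of_re_pos {p A B : ℝ} (hp : 0 < p) (hB : 0 ≤ B)
    (hAB : ∀ w : ℂ, 0 < w.re → ‖w‖ ^ p ≤ A * w.re ^ p - B * (w ^ (p : ℂ)).re)
    {F : ℂ → ℂ} (hF : Differentiable ℂ F) (h : ∀ z ∈ Metric.sphere (0:ℂ) 1, 0 < (F z).re)
    (h0 : (F 0).im = 0) :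
    ∫ θ, ‖F (circleMap 0 1 θ)‖ ^ p ∂circMeas ≤
      A * ∫ θ, (F (circleMap 0 1 θ)).re ^ p ∂circMeas := by
  have hpos : ∀ z ∈ Metric.closedBall (0:ℂ) 1, 0 < (F z).re :=
    fun z hz => re_pos_of_re_pos_on_circle hF h hz
  have hG : DiffContOnCl ℂ (fun z => F z ^ (p:ℂ)) (Metric.ball 0 |1|) := by
    rw [abs_one]
    apply DifferentiableOn.diffContOnCl
    rw [closure_ball _ one_ne_zero]
    intro z hz
    exact ((hF z).cpow_const (Or.inl (hpos z hz))).differentiableWithinAt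
  have hmv := hG.circleAverage
  rw [Real.circleAverage, ← integral_circMeas] at hmv
  have hmem : ∀ θ : ℝ, circleMap 0 1 θ ∈ Metric.sphere (0:ℂ) 1 := fun θ =>
    circleMap_mem_sphere _ zero_le_one _
  have hFc : Continuous fun θ : ℝ => F (circleMap 0 1 θ) :=
    hF.continuous.comp (continuous_circleMap 0 1)
  have hGc : Continuous fun θ : ℝ => F (circleMap 0 1 θ) ^ (p:ℂ) :=
    hFc.cpow continuous_const fun θ => Or.inl (h _ (hmem θ))
  have h1 : 0 ≤ ∫ θ, (F (circleMap 0 1 θ) ^ (p:ℂ)).re ∂circMeas := by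
    have := integral_re (𝕜 := ℂ) (integrable_circMeas hGc)
    simp only [RCLike.re_eq_complex_re] at this
    rw [this, hmv]
    have hF0 := hpos 0 (by simp)
    have : F 0 = ((F 0).re : ℂ) := Complex.ext rfl (by simpa using h0)
    rw [this, ← Complex.ofReal_cpow hF0.le, Complex.ofReal_re]
    positivity
  have i1 : Integrable (fun θ => (F (circleMap 0 1 θ)).re ^ p) circMeas :=
    integrable_circMeas ((Complex.continuous_re.comp hFc).rpow_const fun _ => Or.inr hp.le)
  have i2 : Integrable (fun θ => (F (circleMap 0 1 θ) ^ (p:ℂ)).re) circMeas :=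
    integrable_circMeas (Complex.continuous_re.comp hGc)
  have i3 : Integrable (fun θ => ‖F (circleMap 0 1 θ)‖ ^ p) circMeas :=
    integrable_circMeas (hFc.norm.rpow_const fun _ => Or.inr hp.le)
  have h2 := integral_mono i3 ((i1.const_mul A).sub (i2.const_mul B))
    fun θ => hAB _ (h _ (hmem θ))
  refine h2.trans ?_
  rw [integral_sub' (i1.const_mul A) (i2.const_mul B), integral_const_mul, integral_const_mul]
  nlinarith

theorem riesz_posTrig {p : ℝ} (hp : 1 < p) (hp2 : p ≤ 2) :
    ∃ K : ℝ, 0 ≤ K ∧ ∀ c, IsPosTrig c →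
      cnorm p (trigEval (freqProj 0 c)) ≤ K * cnorm p (trigEval c) := by
  obtain ⟨A, B, hA, hB, hAB⟩ := exists_angle_ineq hp hp2
  have hp0 : 0 < p := by linarith
  refine ⟨(A ^ (1 / p) + 1) / 2, by positivity, fun c hc => ?_⟩
  have hreal : ∀ θ, (starRingEnd ℂ) (trigEval c θ) = trigEval c θ := fun θ => by
    obtain ⟨t, -, ht⟩ := hc θ
    rw [ht, Complex.conj_ofReal]
  have h2re := trigEval_eq_two_re hreal
  have hc0 : c 0 = ∫ θ, trigEval c θ ∂circMeas := by
    rw [← integral_trigEval_mul_conj_exp c 0]; simp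
  have hc0n : ‖c 0‖ ≤ cnorm p (trigEval c) := by
    rw [hc0]; exact norm_integral_le_cnorm hp.le (continuous_trigEval c)
  have hc0im : (c 0).im = 0 := by
    rw [← Complex.conj_eq_iff_im, hc0, ← integral_conj]
    simp only [hreal]
  set F : ℂ → ℂ := fun z => 2 * (∑ n ∈ (freqProj 0 c).support, c n * z ^ n.toNat) - c 0 with hF
  have hFd : Differentiable ℂ F := by
    rw [hF]; fun_prop
  have hsupp : ∀ n ∈ (freqProj 0 c).support, 0 ≤ n := fun n hn => by
    rw [freqProj, Finsupp.support_filter, Finset.mem_filter] at hn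
    exact hn.2
  have hFcirc : ∀ θ : ℝ, F (circleMap 0 1 θ) = 2 * trigEval (freqProj 0 c) θ - c 0 := by
    intro θ
    simp only [hF]
    rw [trigEval_apply]
    congr 2
    refine Finset.sum_congr rfl fun n hn => ?_
    have h0 := hsupp n hn
    rw [freqProj_apply, if_pos h0, circleMap, Complex.ofReal_one, zero_add, one_mul,
      ← Complex.exp_nat_mul]
    congr 2
    have : ((n.toNat : ℕ) : ℂ) = (n : ℂ) := by
      exact_mod_cast congrArg (fun m : ℤ => (m : ℂ)) (Int.toNat_of_nonneg h0)
    rw [this]; ring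
  have hFre : ∀ θ : ℝ, ((F (circleMap 0 1 θ)).re : ℂ) = trigEval c θ := fun θ => by
    rw [hFcirc, h2re θ, Complex.add_conj]
    have : c 0 = ((c 0).re : ℂ) := Complex.ext rfl (by simpa using hc0im)
    rw [this]
    simp
  have hFpos : ∀ z ∈ Metric.sphere (0:ℂ) 1, 0 < (F z).re := by
    intro z hz
    obtain ⟨θ, rfl⟩ : ∃ θ, circleMap 0 1 θ = z := by
      have := range_circleMap (0:ℂ) 1
      rw [abs_one] at this
      rw [← this] at hz
      exact hz
    obtain ⟨t, ht, hte⟩ := hc θ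
    have := hFre θ
    rw [hte] at this
    rw [Complex.ofReal_injective this]
    exact ht
  have hF0 : (F 0).im = 0 := by
    have : F 0 = c 0 := by
      simp only [hF]
      by_cases h0 : (0:ℤ) ∈ (freqProj 0 c).support
      · rw [Finset.sum_eq_single_of_mem 0 h0]
        · simp; ring
        · intro n hn hne
          have := hsupp n hn
          rw [zero_pow (by omega), mul_zero]
      · rw [Finset.sum_eq_zero]
        · have := Finsupp.notMem_support_iff.1 h0
          rw [freqProj_apply, if_pos le_rfl] at this
          simp [this]
        · intro n hn
          have h1 := hsupp n hn
          have h2 : n ≠ 0 := by rintro rfl; exact h0 hn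
          rw [zero_pow (by omega), mul_zero]
    rw [this, hc0im]
  have hmain := integral_norm_rpow_le_of_re_pos hp0 hB hAB hFd hFpos hF0
  have hFc : Continuous fun θ : ℝ => F (circleMap 0 1 θ) :=
    hFd.continuous.comp (continuous_circleMap 0 1)
  have hreab : ∀ θ : ℝ, (F (circleMap 0 1 θ)).re = ‖trigEval c θ‖ := fun θ => by
    rw [← hFre, Complex.norm_real, Real.norm_of_nonneg]
    exact (hFpos _ (circleMap_mem_sphere _ zero_le_one _)).le
  simp only [hreab] at hmain
  rw [← cnorm_rpow hp0 hFc, ← cnorm_rpow hp0 (continuous_trigEval c)] at hmain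
  have h3 : cnorm p (fun θ : ℝ => F (circleMap 0 1 θ)) ≤ A ^ (1 / p) * cnorm p (trigEval c) := by
    have := Real.rpow_le_rpow (Real.rpow_nonneg (cnorm_nonneg _ _) _) hmain
      (by positivity : 0 ≤ 1 / p)
    rwa [Real.mul_rpow hA (Real.rpow_nonneg (cnorm_nonneg _ _) _), ← Real.rpow_mul
      (cnorm_nonneg _ _), ← Real.rpow_mul (cnorm_nonneg _ _), mul_one_div_cancel hp0.ne',
      Real.rpow_one, Real.rpow_one] at this
  have h4 : trigEval (freqProj 0 c) = fun θ => (1 / 2 : ℂ) * (F (circleMap 0 1 θ) + c 0) := by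
    funext θ; rw [hFcirc]; ring
  rw [h4, cnorm_const_mul]
  have h5 := (cnorm_add_le hp.le hFc (continuous_const (y := c 0))).trans
    (add_le_add h3 ((cnorm_le_of_bound (fun _ => le_rfl)).trans hc0n))
  have h6 : ‖(1 / 2 : ℂ)‖ = 1 / 2 := by simp
  rw [h6]
  linarith

/-- If the Riesz projection is bounded on positive trigonometric polynomials in `L^p`, it is
bounded in `L^{p'}`. -/
theorem freqProj_dual {p p' : ℝ} (hpp : p.HolderConjugate p') {K : ℝ} (hK : 0 ≤ K) {N : ℤ}
    (h : ∀ c, IsPosTrig c → cnorm p (trigEval (freqProj N c)) ≤ K * cnorm p (trigEval c))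
    (c : ℤ →₀ ℂ) : cnorm p' (trigEval (freqProj N c)) ≤ 4 * K * cnorm p' (trigEval c) := by
  rw [mul_assoc]
  refine cnorm_le_of_posTrig hpp.symm (continuous_trigEval _) (periodic_trigEval _)
    (mul_nonneg hK (cnorm_nonneg _ _)) fun d hd => ?_
  rw [integral_freqProj_symm]
  refine (norm_integral_mul_le_cnorm hpp.symm (continuous_trigEval _)
    (Complex.continuous_conj.comp (continuous_trigEval _))).trans ?_
  have : cnorm p (fun θ => (starRingEnd ℂ) (trigEval (freqProj N d) θ)) =
      cnorm p (trigEval (freqProj N d)) := cnorm_congr_norm p fun θ => by simp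
  change cnorm p' (trigEval c) * cnorm p (fun θ => (starRingEnd ℂ) (trigEval (freqProj N d) θ)) ≤ _
  rw [this]
  nlinarith [h d hd, cnorm_nonneg p' (trigEval c)]

/-- M. Riesz's theorem. -/
theorem riesz_projection {p : ℝ} (hp : 1 < p) :
    ∃ K : ℝ, 0 ≤ K ∧ ∀ c, cnorm p (trigEval (freqProj 0 c)) ≤ K * cnorm p (trigEval c) := by
  have hpp := Real.HolderConjugate.conjExponent hp
  rcases le_total p 2 with h2 | h2
  · obtain ⟨K, hK, h⟩ := riesz_posTrig hp h2
    refine ⟨4 * (4 * K), by positivity, freqProj_dual hpp.symm (by positivity) fun c _ => ?_⟩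
    exact freqProj_dual hpp hK h c
  · obtain ⟨K, hK, h⟩ := riesz_posTrig hpp.symm.lt (by
      rw [Real.conjExponent, div_le_iff₀ (by linarith)]; linarith)
    exact ⟨4 * K, by positivity, freqProj_dual hpp.symm hK h⟩

theorem riesz_freqProj {p : ℝ} (hp : 1 < p) :
    ∃ K : ℝ, 0 ≤ K ∧ ∀ N c, cnorm p (trigEval (freqProj N c)) ≤ K * cnorm p (trigEval c) := by
  obtain ⟨K, hK, h⟩ := riesz_projection hp
  refine ⟨K, hK, fun N c => ?_⟩
  let s : (ℤ →₀ ℂ) → (ℤ →₀ ℂ) := fun c => c.embDomain (addRightEmbedding (-N))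
  have hs : ∀ c θ, trigEval (s c) θ = Complex.exp (((-N : ℤ) : ℂ) * θ * Complex.I) * trigEval c θ := by
    intro c θ
    rw [trigEval_apply, trigEval_apply, Finset.mul_sum, Finsupp.support_embDomain, Finset.sum_map]
    refine Finset.sum_congr rfl fun n _ => ?_
    rw [Finsupp.embDomain_apply_self, mul_left_comm, ← Complex.exp_add]
    congr 2
    simp only [addRightEmbedding_apply]
    push_cast; ring
  have hs2 : freqProj 0 (s c) = s (freqProj N c) := by
    ext m
    have hm : m = addRightEmbedding (-N) (m + N) := by simp
    rw [freqProj_apply, hm, Finsupp.embDomain_apply_self, Finsupp.embDomain_apply_self,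
      freqProj_apply]
    simp only [addRightEmbedding_apply]
    congr 1
    rw [eq_iff_iff]
    constructor <;> intro <;> omega
  have hn : ∀ c, cnorm p (trigEval (s c)) = cnorm p (trigEval c) := fun c =>
    cnorm_congr_norm p fun θ => by
      rw [hs, norm_mul, Complex.norm_exp]
      simp
  have := h (s c)
  rwa [hs2, hn, hn] at this

theorem freqProj_eq_single_add (n : ℤ) (c : ℤ →₀ ℂ) :
    freqProj n c = Finsupp.single n (c n) + freqProj (n + 1) c := by
  ext k
  rw [Finsupp.add_apply, freqProj_apply, freqProj_apply, Finsupp.single_apply]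
  rcases lt_trichotomy k n with h | rfl | h
  · simp [h.not_ge, h.ne', show ¬ (n + 1 ≤ k) by omega]
  · simp
  · simp [h.le, h.ne, show n + 1 ≤ k by omega]

theorem sum_mul_eq_of_tails (m : ℕ → ℂ) (a T : ℕ → ℂ) (hT : ∀ n, T n = a n + T (n + 1)) (N : ℕ) :
    ∑ k ∈ Finset.range (N + 1), m k * a k =
      m 0 * T 0 + ∑ n ∈ Finset.range N, (m (n + 1) - m n) * T (n + 1) - m N * T (N + 1) := by
  induction N with
  | zero => simp [hT 0]; ring
  | succ N ih =>
    rw [Finset.sum_range_succ, ih, Finset.sum_range_succ (n := N), hT (N + 1)]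
    ring

/-- Fourier multipliers of bounded variation are controlled by the analytic projections. -/
theorem cnorm_multiplier_le {p K : ℝ} (hp : 1 < p)
    (hK : ∀ N c, cnorm p (trigEval (freqProj N c)) ≤ K * cnorm p (trigEval c))
    (m : ℕ → ℝ) (c : ℤ →₀ ℂ) {N : ℕ} (hN : ∀ n : ℤ, (N:ℤ) < n → c n = 0) :
    cnorm p (fun θ => ∑ k ∈ Finset.range (N + 1),
        (m k : ℂ) * (c (k:ℤ) * Complex.exp ((k:ℂ) * θ * Complex.I))) ≤
      (|m 0| + ∑ n ∈ Finset.range N, |m (n + 1) - m n|) * (K * cnorm p (trigEval c)) := by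
  have hT0 : ∀ θ, trigEval (freqProj ((N + 1 : ℕ) : ℤ) c) θ = 0 := fun θ => by
    have : freqProj ((N + 1 : ℕ) : ℤ) c = 0 := by
      ext k
      rw [freqProj_apply]
      split_ifs with h
      · exact hN k (by push_cast at h; omega)
      · rfl
    rw [this, trigEval_apply]; simp
  have key : ∀ θ : ℝ, ∑ k ∈ Finset.range (N + 1),
      (m k : ℂ) * (c (k:ℤ) * Complex.exp ((k:ℂ) * θ * Complex.I)) =
      (m 0 : ℂ) * trigEval (freqProj ((0 : ℕ) : ℤ) c) θ + ∑ n ∈ Finset.range N,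
        ((m (n + 1) - m n : ℝ) : ℂ) * trigEval (freqProj ((n + 1 : ℕ) : ℤ) c) θ := fun θ => by
    rw [sum_mul_eq_of_tails (fun k => (m k : ℂ)) _ (fun n => trigEval (freqProj (n : ℤ) c) θ)]
    · rw [hT0]; simp
    · intro n
      rw [freqProj_eq_single_add, trigEval_add, trigEval_single]
      simp
  simp only [key]
  refine (cnorm_add_le hp.le (continuous_const.mul (continuous_trigEval _))
    (continuous_finsetSum _ fun n _ => continuous_const.mul (continuous_trigEval _))).trans ?_
  rw [add_mul, Finset.sum_mul]
  refine add_le_add ?_ ((cnorm_sum_le hp.le _ _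
    fun n _ => continuous_const.mul (continuous_trigEval _)).trans
      (Finset.sum_le_sum fun n _ => ?_))
  · refine (cnorm_const_mul _ _ _).le.trans ?_
    rw [Complex.norm_real, Real.norm_eq_abs]
    gcongr
    exact hK _ _
  · refine (cnorm_const_mul _ _ _).le.trans ?_
    rw [Complex.norm_real, Real.norm_eq_abs]
    gcongr
    exact hK _ _

theorem variation_mul_le {a b : ℕ → ℝ} (ha : Antitone a) (ha0 : ∀ n, 0 ≤ a n) (hb : Monotone b)
    (hb0 : ∀ n, 0 ≤ b n) (N : ℕ) :
    |a 0 * b 0| + ∑ n ∈ Finset.range N, |a (n + 1) * b (n + 1) - a n * b n| ≤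
      2 * ∑ n ∈ Finset.range N, (a n - a (n + 1)) * b n + a N * b N := by
  have h : ∀ n, |a (n + 1) * b (n + 1) - a n * b n| ≤
      2 * ((a n - a (n + 1)) * b n) + (a (n + 1) * b (n + 1) - a n * b n) := fun n => by
    have h1 := mul_nonneg (sub_nonneg.2 (ha n.le_succ)) (hb0 n)
    have h2 := mul_nonneg (ha0 (n + 1)) (sub_nonneg.2 (hb n.le_succ))
    simp only [Nat.succ_eq_add_one] at h1 h2
    rw [abs_le]
    constructor <;> nlinarith
  have := Finset.sum_le_sum fun n (_ : n ∈ Finset.range N) => h n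
  rw [Finset.sum_add_distrib, ← Finset.mul_sum,
    Finset.sum_range_sub (fun n => a n * b n)] at this
  rw [abs_of_nonneg (mul_nonneg (ha0 0) (hb0 0))]
  linarith

/-- The multiplier `x^k / κ_k`, for a decreasing sequence `κ` that dominates `y^{2k}`. -/
theorem cnorm_pow_div_multiplier_le {p K : ℝ} (hp : 1 < p) (hK0 : 0 ≤ K)
    (hK : ∀ N c, cnorm p (trigEval (freqProj N c)) ≤ K * cnorm p (trigEval c))
    {κ : ℕ → ℝ} (hκ : Antitone κ) (hκ0 : ∀ k, 0 < κ k) {x D : ℝ} (hx0 : 0 ≤ x) (hx1 : x < 1)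
    (hD : ∀ k, ((3 + x) / 4) ^ (2 * k) ≤ D * κ k)
    (c : ℤ →₀ ℂ) {N : ℕ} (hN : ∀ n : ℤ, (N:ℤ) < n → c n = 0) :
    cnorm p (fun θ => ∑ k ∈ Finset.range (N + 1),
        ((x ^ k / κ k : ℝ) : ℂ) * (c (k:ℤ) * Complex.exp ((k:ℂ) * θ * Complex.I))) ≤
      9 * D * (K * cnorm p (trigEval c)) := by
  refine (cnorm_multiplier_le hp hK (fun k => x ^ k / κ k) c hN).trans ?_
  refine mul_le_mul_of_nonneg_right ?_ (mul_nonneg hK0 (cnorm_nonneg _ _))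
  set y := (3 + x) / 4 with hy
  have hy0 : 0 < y := by positivity
  have hy1 : y < 1 := by rw [hy]; linarith
  have hxy : x ≤ y ^ 4 := by
    have := one_add_mul_le_pow (a := -((1 - x) / 4)) (by linarith) 4
    have h2 : 1 + -((1 - x) / 4) = y := by rw [hy]; ring
    rw [h2] at this
    push_cast at this
    linarith
  have hb : ∀ k, x ^ k * (κ k)⁻¹ ≤ D * (y ^ 2) ^ k := fun k => by
    rw [← div_eq_mul_inv, div_le_iff₀ (hκ0 k)]
    calc x ^ k ≤ (y ^ 4) ^ k := by gcongr
      _ = (y ^ 2) ^ k * y ^ (2 * k) := by rw [← pow_mul, ← pow_mul, ← pow_add]; congr 1; ring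
      _ ≤ (y ^ 2) ^ k * (D * κ k) := by gcongr; exact hD k
      _ = _ := by ring
  have hD0 : 0 ≤ D := by
    have := hb 0
    have h1 := inv_pos.2 (hκ0 0)
    simp at this; linarith
  have h1 := variation_mul_le (a := fun k => x ^ k) (b := fun k => (κ k)⁻¹)
    (fun i j hij => pow_le_pow_of_le_one hx0 hx1.le hij) (fun n => by positivity)
    (fun i j hij => inv_anti₀ (hκ0 j) (hκ hij)) (fun n => (inv_pos.2 (hκ0 n)).le) N
  simp only [div_eq_mul_inv]
  refine h1.trans ?_
  have hN' : x ^ N * (κ N)⁻¹ ≤ D :=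
    (hb N).trans (mul_le_of_le_one_right hD0 (pow_le_one₀ (by positivity) (by nlinarith)))
  have hs : ∑ n ∈ Finset.range N, (x ^ n - x ^ (n + 1)) * (κ n)⁻¹ ≤ 4 * D := by
    calc ∑ n ∈ Finset.range N, (x ^ n - x ^ (n + 1)) * (κ n)⁻¹
        ≤ ∑ n ∈ Finset.range N, (1 - x) * (D * (y ^ 2) ^ n) := by
          refine Finset.sum_le_sum fun n _ => ?_
          rw [show (x ^ n - x ^ (n + 1)) * (κ n)⁻¹ = (1 - x) * (x ^ n * (κ n)⁻¹) by ring]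
          exact mul_le_mul_of_nonneg_left (hb n) (by linarith)
      _ = (1 - x) * D * ∑ n ∈ Finset.range N, (y ^ 2) ^ n := by
          rw [Finset.mul_sum]; exact Finset.sum_congr rfl fun n _ => by ring
      _ ≤ (4 * (1 - y ^ 2)) * D * ∑ n ∈ Finset.range N, (y ^ 2) ^ n := by
          gcongr
          rw [hy]; nlinarith
      _ = 4 * D * (1 - (y ^ 2) ^ N) := by
          rw [← mul_neg_geom_sum (y ^ 2) N]; ring
      _ ≤ 4 * D := mul_le_of_le_one_right (by positivity) (by
          have : 0 ≤ (y ^ 2) ^ N := by positivity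
          linarith)
  linarith

theorem continuous_circlePt (r : ℝ) : Continuous (circlePt r) := by
  unfold circlePt; fun_prop

theorem norm_circlePt (r θ : ℝ) : ‖circlePt r θ‖ = |r| := by
  simp [circlePt, Complex.norm_exp]

theorem circlePt_mem_ball {r : ℝ} (hr : r ∈ Ico (0:ℝ) 1) (θ : ℝ) :
    circlePt r θ ∈ Metric.ball (0:ℂ) 1 := by
  simpa [norm_circlePt, abs_of_nonneg hr.1] using hr.2

theorem circlePt_pow (r θ : ℝ) (k : ℕ) :
    circlePt r θ ^ k = (r:ℂ) ^ k * Complex.exp ((k:ℂ) * θ * Complex.I) := by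
  rw [circlePt, mul_pow, ← Complex.exp_nat_mul]
  congr 2; ring

theorem continuous_comp_circlePt {f : ℂ → ℂ} (hf : DifferentiableOn ℂ f (Metric.ball 0 1))
    {r : ℝ} (hr : r ∈ Ico (0:ℝ) 1) : Continuous fun θ => f (circlePt r θ) :=
  hf.continuousOn.comp_continuous (continuous_circlePt r) (circlePt_mem_ball hr)

theorem periodic_comp_circlePt (f : ℂ → ℂ) (r : ℝ) :
    Function.Periodic (fun θ => f (circlePt r θ)) (2 * Real.pi) := by
  intro θ
  simp only [circlePt]
  congr 2
  rw [Complex.exp_eq_exp_iff_exists_int]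
  exact ⟨1, by push_cast; ring⟩

theorem hasSum_taylorCoeff {f : ℂ → ℂ} (hf : DifferentiableOn ℂ f (Metric.ball 0 1))
    {z : ℂ} (hz : ‖z‖ < 1) : HasSum (fun k => taylorCoeff f k * z ^ k) (f z) := by
  have := Complex.hasSum_taylorSeries_on_ball hf (z := z) (by simpa using hz)
  simp only [sub_zero, smul_eq_mul] at this
  simpa only [taylorCoeff, div_eq_mul_inv, mul_comm, mul_left_comm] using this

theorem summable_norm_taylorCoeff {f : ℂ → ℂ} (hf : DifferentiableOn ℂ f (Metric.ball 0 1))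
    {r : ℝ} (hr : r ∈ Ico (0:ℝ) 1) : Summable fun k => ‖taylorCoeff f k‖ * r ^ k := by
  have := (hasSum_taylorCoeff hf (z := (r:ℂ)) (by
    simpa [abs_of_nonneg hr.1] using hr.2)).summable.norm
  simpa [abs_of_nonneg hr.1] using this

theorem hasSum_integral_exp_mul {u : ℕ → ℂ} (hu : Summable fun k => ‖u k‖) {F φ : ℝ → ℂ}
    (hF : ∀ θ : ℝ, HasSum (fun k => u k * Complex.exp ((k:ℂ) * θ * Complex.I)) (F θ))
    (hφ : Continuous φ) :
    HasSum (fun k => u k * ∫ θ : ℝ, Complex.exp ((k:ℂ) * θ * Complex.I) * φ θ ∂circMeas)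
      (∫ θ, F θ * φ θ ∂circMeas) := by
  have h1 : ∀ k : ℕ, Continuous fun θ : ℝ =>
      u k * (Complex.exp ((k:ℂ) * θ * Complex.I) * φ θ) := fun k => by fun_prop
  have h2 : ∀ (k : ℕ) (θ : ℝ), ‖u k * (Complex.exp ((k:ℂ) * θ * Complex.I) * φ θ)‖ =
      ‖u k‖ * ‖φ θ‖ := fun k θ => by simp [Complex.norm_exp]
  have := hasSum_integral_of_summable_integral_norm (μ := circMeas)
    (F := fun (k : ℕ) (θ : ℝ) => u k * (Complex.exp ((k:ℂ) * θ * Complex.I) * φ θ))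
    (fun k => integrable_circMeas (h1 k)) (by
      simp only [h2, integral_const_mul]
      exact hu.mul_right _)
  simp only [integral_const_mul] at this
  have h3 : ∀ θ : ℝ, ∑' k : ℕ, u k * (Complex.exp ((k:ℂ) * θ * Complex.I) * φ θ) = F θ * φ θ :=
    fun θ => by simpa only [← mul_assoc] using ((hF θ).mul_right (φ θ)).tsum_eq
  simpa only [h3] using this

theorem integral_mul_conj_exp_of_hasSum {u : ℕ → ℂ} (hu : Summable fun k => ‖u k‖) {F : ℝ → ℂ}
    (hF : ∀ θ : ℝ, HasSum (fun k => u k * Complex.exp ((k:ℂ) * θ * Complex.I)) (F θ)) (n : ℤ) :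
    ∫ θ : ℝ, F θ * (starRingEnd ℂ) (Complex.exp ((n:ℂ) * θ * Complex.I)) ∂circMeas =
      if 0 ≤ n then u n.toNat else 0 := by
  refine (hasSum_integral_exp_mul hu hF (by fun_prop)).unique ?_
  have h : ∀ k : ℕ, ∫ θ : ℝ, Complex.exp ((k:ℂ) * θ * Complex.I) *
      (starRingEnd ℂ) (Complex.exp ((n:ℂ) * θ * Complex.I)) ∂circMeas =
      if (k:ℤ) = n then 1 else 0 := fun k => by
    rw [← integral_exp_mul_conj_exp]; simp
  simp only [h]
  split_ifs with hn
  · lift n to ℕ using hn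
    rw [Int.toNat_natCast]
    convert hasSum_ite_eq n (u n) using 2 with k
    by_cases hk : k = n <;> simp [hk]
  · convert hasSum_zero with k
    rw [if_neg (by omega), mul_zero]

theorem hasSum_taylor_circlePt {f : ℂ → ℂ} (hf : DifferentiableOn ℂ f (Metric.ball 0 1))
    {r : ℝ} (hr : r ∈ Ico (0:ℝ) 1) (θ : ℝ) :
    HasSum (fun k : ℕ => taylorCoeff f k * (r:ℂ) ^ k * Complex.exp ((k:ℂ) * θ * Complex.I))
      (f (circlePt r θ)) := by
  have := hasSum_taylorCoeff hf (z := circlePt r θ) (by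
    rw [norm_circlePt, abs_of_nonneg hr.1]; exact hr.2)
  simpa only [circlePt_pow, ← mul_assoc] using this

theorem summable_norm_taylor_circle {f : ℂ → ℂ} (hf : DifferentiableOn ℂ f (Metric.ball 0 1))
    {r : ℝ} (hr : r ∈ Ico (0:ℝ) 1) : Summable fun k => ‖taylorCoeff f k * (r:ℂ) ^ k‖ := by
  simpa [abs_of_nonneg hr.1] using summable_norm_taylorCoeff hf hr

theorem integral_circlePt_mul_conj_exp {f : ℂ → ℂ} (hf : DifferentiableOn ℂ f (Metric.ball 0 1))
    {r : ℝ} (hr : r ∈ Ico (0:ℝ) 1) (n : ℤ) :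
    ∫ θ : ℝ, f (circlePt r θ) * (starRingEnd ℂ) (Complex.exp ((n:ℂ) * θ * Complex.I)) ∂circMeas =
      if 0 ≤ n then taylorCoeff f n.toNat * (r:ℂ) ^ n.toNat else 0 :=
  integral_mul_conj_exp_of_hasSum (summable_norm_taylor_circle hf hr)
    (hasSum_taylor_circlePt hf hr) n

theorem hasSum_integral_mul_conj {f g : ℂ → ℂ} (hf : DifferentiableOn ℂ f (Metric.ball 0 1))
    (hg : DifferentiableOn ℂ g (Metric.ball 0 1)) {r : ℝ} (hr : r ∈ Ico (0:ℝ) 1) :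
    HasSum (fun k : ℕ => taylorCoeff f k * (starRingEnd ℂ) (taylorCoeff g k) * (r:ℂ) ^ (2 * k))
      (∫ θ, f (circlePt r θ) * (starRingEnd ℂ) (g (circlePt r θ)) ∂circMeas) := by
  have := hasSum_integral_exp_mul (summable_norm_taylor_circle hf hr)
    (hasSum_taylor_circlePt hf hr)
    (φ := fun θ => (starRingEnd ℂ) (g (circlePt r θ)))
    (Complex.continuous_conj.comp (continuous_comp_circlePt hg hr))
  convert this using 2 with k
  have h := congrArg (starRingEnd ℂ) (integral_circlePt_mul_conj_exp hg hr (k:ℤ))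
  rw [← integral_conj] at h
  simp only [map_mul, Complex.conj_conj, Int.natCast_nonneg, if_true, Int.toNat_natCast, map_pow,
    Complex.conj_ofReal, Int.cast_natCast] at h
  have h' : ∀ θ : ℝ, Complex.exp ((k:ℂ) * θ * Complex.I) * (starRingEnd ℂ) (g (circlePt r θ)) =
    (starRingEnd ℂ) (g (circlePt r θ)) * Complex.exp ((k:ℂ) * θ * Complex.I) :=
    fun θ => mul_comm _ _
  simp only [h', h]
  ring

/-- A power series with radius of convergence at least one is analytic in the disc. -/
theorem differentiableOn_tsum_pow {a : ℕ → ℂ}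
    (ha : ∀ r ∈ Ico (0:ℝ) 1, Summable fun k => ‖a k‖ * r ^ k) :
    DifferentiableOn ℂ (fun z => ∑' k, a k * z ^ k) (Metric.ball 0 1) := by
  intro z hz
  obtain ⟨r, hzr, hr⟩ := exists_between (mem_ball_zero_iff.1 hz)
  have := Complex.differentiableOn_tsum_of_summable_norm (ha r ⟨(norm_nonneg z).trans hzr.le, hr⟩)
    (F := fun k z => a k * z ^ k) (fun k => by fun_prop) (Metric.isOpen_ball (x := (0:ℂ)) (ε := r))
    (fun k w hw => by
      rw [norm_mul, norm_pow]
      have := (mem_ball_zero_iff.1 hw).le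
      gcongr)
  exact (this.differentiableAt (Metric.isOpen_ball.mem_nhds (mem_ball_zero_iff.2 hzr))
    ).differentiableWithinAt

theorem taylorCoeff_tsum_pow {a : ℕ → ℂ}
    (ha : ∀ r ∈ Ico (0:ℝ) 1, Summable fun k => ‖a k‖ * r ^ k) (n : ℕ) :
    taylorCoeff (fun z => ∑' k, a k * z ^ k) n = a n := by
  have hr : (1/2:ℝ) ∈ Ico (0:ℝ) 1 := by norm_num
  have hu : Summable fun k => ‖a k * ((1/2:ℝ):ℂ) ^ k‖ := by
    simpa using ha _ hr
  have h1 := integral_mul_conj_exp_of_hasSum hu (F := fun θ => ∑' k, a k * circlePt (1/2) θ ^ k)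
    (fun θ => by
      have : Summable fun k => a k * circlePt (1/2) θ ^ k := by
        refine Summable.of_norm ?_
        simpa [norm_circlePt] using ha _ hr
      simpa only [circlePt_pow, ← mul_assoc] using this.hasSum) n
  rw [integral_circlePt_mul_conj_exp (differentiableOn_tsum_pow ha) hr] at h1
  simpa using h1

theorem cnorm_comp_add {p : ℝ} (hp : 0 < p) {φ : ℝ → ℂ} (hφ : Continuous φ)
    (hper : Function.Periodic φ (2 * Real.pi)) (α : ℝ) :
    cnorm p (fun θ => φ (θ + α)) = cnorm p φ := by
  rw [cnorm_eq hp hφ, cnorm_eq hp (by fun_prop), integral_circMeas, integral_circMeas,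
    intervalIntegral.integral_comp_add_right (fun θ => ‖φ θ‖ ^ p)]
  have hper' : Function.Periodic (fun θ => ‖φ θ‖ ^ p) (2 * Real.pi) := fun θ => by
    simp only [hper θ]
  have := hper'.intervalIntegral_add_eq α 0
  rw [zero_add] at this
  rw [zero_add, add_comm (2 * Real.pi), this]

/-- The integral means of an analytic function are increasing. -/
theorem cnorm_circlePt_mono {p : ℝ} (hp : 1 < p) {f : ℂ → ℂ}
    (hf : DifferentiableOn ℂ f (Metric.ball 0 1)) {r R : ℝ} (h0 : 0 ≤ r) (hrR : r ≤ R)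
    (hR : R < 1) : cnorm p (fun θ => f (circlePt r θ)) ≤ cnorm p (fun θ => f (circlePt R θ)) := by
  rcases hrR.eq_or_lt with rfl | hrR
  · exact le_rfl
  have hr' : r ∈ Ico (0:ℝ) 1 := ⟨h0, hrR.trans hR⟩
  have hR' : R ∈ Ico (0:ℝ) 1 := ⟨h0.trans hrR.le, hR⟩
  have hpp := Real.HolderConjugate.conjExponent hp
  have hφ := continuous_comp_circlePt hf hr'
  refine cnorm_le_of_dualElt hp hφ (cnorm_nonneg _ _) ?_
  rw [← cnorm_dualElt hpp hφ]
  set ψ : ℝ → ℂ := fun θ => (starRingEnd ℂ) (dualElt p (f (circlePt r θ))) with hψ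
  have hψc : Continuous ψ :=
    Complex.continuous_conj.comp ((continuous_dualElt hp).comp hφ)
  have hψn : cnorm (Real.conjExponent p) (fun θ => dualElt p (f (circlePt r θ))) =
    cnorm (Real.conjExponent p) ψ := cnorm_congr_norm _ fun θ => by simp [hψ]
  rw [hψn]
  set m : ℕ → ℂ := fun k => ∫ θ : ℝ, Complex.exp ((k:ℂ) * θ * Complex.I) * ψ θ ∂circMeas with hm
  have hmb : ∀ k, ‖m k‖ ≤ ∫ θ, ‖ψ θ‖ ∂circMeas := fun k => by
    refine (norm_integral_le_integral_norm _).trans_eq ?_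
    congr 1; funext θ
    simp [Complex.norm_exp]
  have ha : ∀ s ∈ Ico (0:ℝ) 1, Summable fun k => ‖taylorCoeff f k * m k‖ * s ^ k := fun s hs => by
    refine Summable.of_nonneg_of_le (fun k => mul_nonneg (norm_nonneg _) (pow_nonneg hs.1 _))
      (fun k => ?_) ((summable_norm_taylorCoeff hf hs).mul_right (∫ θ, ‖ψ θ‖ ∂circMeas))
    rw [norm_mul, mul_right_comm]
    exact mul_le_mul_of_nonneg_left (hmb k) (mul_nonneg (norm_nonneg _) (pow_nonneg hs.1 _))
  have hH := differentiableOn_tsum_pow ha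
  have hval : ∀ s ∈ Ico (0:ℝ) 1, ∀ α : ℝ, ∑' k, taylorCoeff f k * m k * circlePt s α ^ k =
      ∫ θ, f (circlePt s (θ + α)) * ψ θ ∂circMeas := fun s hs α => by
    rw [← (hasSum_integral_exp_mul (u := fun k => taylorCoeff f k * circlePt s α ^ k) ?_ ?_
      hψc).tsum_eq]
    · congr 1; funext k; simp only [hm]; ring
    · simpa [norm_circlePt, abs_of_nonneg hs.1] using summable_norm_taylorCoeff hf hs
    · intro θ
      have := hasSum_taylor_circlePt hf hs (θ + α)
      convert this using 2 with k
      have h : ((k:ℂ) * ((θ + α : ℝ) : ℂ) * Complex.I) =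
        (k:ℂ) * α * Complex.I + (k:ℂ) * θ * Complex.I := by push_cast; ring
      rw [h, Complex.exp_add, circlePt_pow]
      ring
  have hmax := Complex.norm_le_of_forall_mem_frontier_norm_le (U := Metric.ball (0:ℂ) R)
    (f := fun z => ∑' k, taylorCoeff f k * m k * z ^ k)
    (C := cnorm p (fun θ => f (circlePt R θ)) * cnorm (Real.conjExponent p) ψ)
    Metric.isBounded_ball
    (hH.diffContOnCl_ball (Metric.closedBall_subset_ball hR)) ?_ (z := circlePt r 0) ?_
  · have := hval r hr' 0
    simp only [add_zero] at this
    rw [this] at hmax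
    exact hmax
  · intro z hz
    rw [frontier_ball _ (h0.trans_lt hrR).ne', mem_sphere_zero_iff_norm] at hz
    have : z = circlePt R z.arg := by
      rw [circlePt, ← hz, Complex.norm_mul_exp_arg_mul_I]
    rw [this, hval R hR']
    refine (norm_integral_mul_le_cnorm hpp (φ := fun θ => f (circlePt R (θ + z.arg)))
      ((continuous_comp_circlePt hf hR').comp (by fun_prop)) hψc).trans_eq ?_
    rw [cnorm_comp_add (φ := fun θ => f (circlePt R θ)) hpp.pos
      (continuous_comp_circlePt hf hR') (periodic_comp_circlePt f R)]
  · refine subset_closure ?_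
    simpa [norm_circlePt, abs_of_nonneg h0] using hrR

theorem IsRadialWeight.intervalIntegrable {ω : ℝ → ℝ} (hω : IsRadialWeight ω) {a b : ℝ}
    (ha : a ∈ Icc (0:ℝ) 1) (hb : b ∈ Icc (0:ℝ) 1) : IntervalIntegrable ω volume a b := by
  have h : IntervalIntegrable ω volume 0 1 := by
    rw [intervalIntegrable_iff_integrableOn_Ico_of_le zero_le_one]
    exact hω.2
  refine h.mono_set ?_
  rw [uIcc_of_le zero_le_one]
  exact uIcc_subset_Icc ha hb

theorem IsRadialWeight.integrableOn_Ioo {ω : ℝ → ℝ} (hω : IsRadialWeight ω) :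
    IntegrableOn ω (Ioo 0 1) := hω.2.mono_set Ioo_subset_Ico_self

theorem omegaHat_one (ω : ℝ → ℝ) : omegaHat ω 1 = 0 := intervalIntegral.integral_same

theorem omegaHat_sub {ω : ℝ → ℝ} (hω : IsRadialWeight ω) {a b : ℝ}
    (ha : a ∈ Icc (0:ℝ) 1) (hb : b ∈ Icc (0:ℝ) 1) :
    omegaHat ω a - omegaHat ω b = ∫ s in a..b, ω s := by
  have h1 : (1:ℝ) ∈ Icc (0:ℝ) 1 := by simp
  rw [omegaHat, omegaHat, sub_eq_iff_eq_add,
    intervalIntegral.integral_add_adjacent_intervals (hω.intervalIntegrable ha hb)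
      (hω.intervalIntegrable hb h1)]

theorem antitoneOn_omegaHat {ω : ℝ → ℝ} (hω : IsRadialWeight ω) :
    AntitoneOn (omegaHat ω) (Icc 0 1) := by
  intro a ha b hb hab
  rw [← sub_nonneg, omegaHat_sub hω ha hb,
    intervalIntegral.integral_of_le hab, integral_Ioc_eq_integral_Ioo]
  exact setIntegral_nonneg measurableSet_Ioo fun s hs =>
    hω.1 s ⟨ha.1.trans hs.1.le, hs.2.trans_le hb.2⟩

theorem continuousOn_omegaHat {ω : ℝ → ℝ} (hω : IsRadialWeight ω) :
    ContinuousOn (omegaHat ω) (Icc 0 1) := by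
  have h := intervalIntegral.continuousOn_primitive_interval' (a := 1) (f := ω) (μ := volume)
    (b₁ := 0) (b₂ := 1) (hω.intervalIntegrable (by simp) (by simp)) (by simp)
  rw [uIcc_of_le zero_le_one] at h
  refine h.neg.congr fun r _ => ?_
  rw [omegaHat, intervalIntegral.integral_symm]
  rfl

theorem omegaHat_nonneg {ω : ℝ → ℝ} (hω : IsRadialWeight ω) {r : ℝ} (hr : r ∈ Icc (0:ℝ) 1) :
    0 ≤ omegaHat ω r :=
  (omegaHat_one ω).symm.le.trans (antitoneOn_omegaHat hω hr (by simp) hr.2)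

theorem exists_omegaHat_eq {ω : ℝ → ℝ} (hω : IsRadialWeight ω) {r t : ℝ}
    (hr : r ∈ Icc (0:ℝ) 1) (ht0 : 0 ≤ t) (ht : t ≤ omegaHat ω r) :
    ∃ a ∈ Icc r 1, omegaHat ω a = t := by
  have := intermediate_value_Icc' hr.2 ((continuousOn_omegaHat hω).mono (Icc_subset_Icc_left hr.1))
  exact this ⟨by rwa [omegaHat_one], ht⟩

theorem lintegral_Ioo_eq_omegaHat {ω : ℝ → ℝ} (hω : IsRadialWeight ω) {r : ℝ}
    (hr : r ∈ Icc (0:ℝ) 1) :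
    ∫⁻ s in Ioo r 1, ENNReal.ofReal (ω s) = ENNReal.ofReal (omegaHat ω r) := by
  rw [omegaHat, intervalIntegral.integral_of_le hr.2, integral_Ioc_eq_integral_Ioo]
  refine (ofReal_integral_eq_lintegral_ofReal
    (hω.integrableOn_Ioo.mono_set (Ioo_subset_Ioo_left hr.1)) ?_).symm
  filter_upwards [ae_restrict_mem measurableSet_Ioo] with s hs
  exact hω.1 s ⟨hr.1.trans hs.1.le, hs.2⟩

/-- The `ω`-mass of a sublevel set of `ω̂`. -/
theorem lintegral_sublevel_omegaHat_le {ω : ℝ → ℝ} (hω : IsRadialWeight ω) {t : ℝ} (ht : 0 ≤ t) :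
    ∫⁻ s in Ioo (0:ℝ) 1 ∩ {s | omegaHat ω s < t}, ENNReal.ofReal (ω s) ≤ ENNReal.ofReal t := by
  rcases le_total t (omegaHat ω 0) with h | h
  · obtain ⟨a, ha, rfl⟩ := exists_omegaHat_eq hω (r := 0) (by simp) ht h
    rw [← lintegral_Ioo_eq_omegaHat hω ha]
    refine lintegral_mono_set fun s hs => ⟨?_, hs.1.2⟩
    by_contra hsa
    exact (antitoneOn_omegaHat hω ⟨hs.1.1.le, hs.1.2.le⟩ ha (not_lt.1 hsa)).not_gt hs.2
  · refine (lintegral_mono_set inter_subset_left).trans ?_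
    rw [lintegral_Ioo_eq_omegaHat hω (by simp)]
    exact ENNReal.ofReal_le_ofReal h

theorem measurableSet_sublevel_omegaHat {ω : ℝ → ℝ} (hω : IsRadialWeight ω) (t : ℝ) :
    MeasurableSet (Ioo (0:ℝ) 1 ∩ {s | omegaHat ω s < t}) := by
  have := ((continuousOn_omegaHat hω).mono Ioo_subset_Icc_self).isOpen_inter_preimage
    isOpen_Ioo (isOpen_Iio (a := t))
  exact this.measurableSet

theorem aemeasurable_ofReal_weight {ω : ℝ → ℝ} (hω : IsRadialWeight ω) :
    AEMeasurable (fun s => ENNReal.ofReal (ω s)) (volume.restrict (Ioo 0 1)) :=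
  hω.integrableOn_Ioo.aestronglyMeasurable.aemeasurable.ennreal_ofReal

theorem exists_pow_two_mul_le {w v : ℝ} (hw : 0 < w) (hv : w ≤ v) :
    ∃ n : ℕ, 2 ^ n * w ≤ v ∧ v < 2 ^ (n + 1) * w := by
  obtain ⟨n, h1, h2⟩ := exists_nat_pow_near ((one_le_div hw).2 hv) one_lt_two
  exact ⟨n, (le_div_iff₀ hw).1 h1, (div_lt_iff₀ hw).1 h2⟩

theorem lintegral_max_omegaHat_rpow_le {q : ℝ} (hq : 0 < q) : ∃ C : ℝ, 0 ≤ C ∧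
    ∀ ω : ℝ → ℝ, IsRadialWeight ω → ∀ w : ℝ, 0 < w →
      ∫⁻ s in Ioo (0:ℝ) 1, ENNReal.ofReal (max (omegaHat ω s) w ^ (-(1 + q)) * ω s) ≤
        ENNReal.ofReal (C * w ^ (-q)) := by
  have hgeo : Summable fun n : ℕ => ((2:ℝ) ^ (-q)) ^ n :=
    summable_geometric_of_lt_one (by positivity)
      (Real.rpow_lt_one_of_one_lt_of_neg one_lt_two (by linarith))
  refine ⟨∑' n : ℕ, 2 * ((2:ℝ) ^ (-q)) ^ n, tsum_nonneg fun n => by positivity,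
    fun ω hω w hw => ?_⟩
  have key : ∀ s ∈ Ioo (0:ℝ) 1, ENNReal.ofReal (max (omegaHat ω s) w ^ (-(1 + q)) * ω s) ≤
      ∑' n : ℕ, (Ioo (0:ℝ) 1 ∩ {s | omegaHat ω s < 2 ^ (n + 1) * w}).indicator
        (fun s => ENNReal.ofReal ((2 ^ n * w) ^ (-(1 + q))) * ENNReal.ofReal (ω s)) s := by
    intro s hs
    obtain ⟨n, h1, h2⟩ := exists_pow_two_mul_le hw (le_max_right (omegaHat ω s) w)
    refine le_trans ?_ (ENNReal.le_tsum n)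
    have hmem : s ∈ Ioo (0:ℝ) 1 ∩ {s | omegaHat ω s < 2 ^ (n + 1) * w} :=
      ⟨hs, (le_max_left _ _).trans_lt h2⟩
    rw [indicator_of_mem hmem, ← ENNReal.ofReal_mul (by positivity)]
    refine ENNReal.ofReal_le_ofReal (mul_le_mul_of_nonneg_right ?_ (hω.1 s ⟨hs.1.le, hs.2⟩))
    exact Real.rpow_le_rpow_of_nonpos (by positivity) h1 (by linarith)
  refine (setLIntegral_mono' measurableSet_Ioo key).trans ?_
  rw [lintegral_tsum]
  · have hn : ∀ n : ℕ, ∫⁻ s in Ioo (0:ℝ) 1,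
        (Ioo (0:ℝ) 1 ∩ {s | omegaHat ω s < 2 ^ (n + 1) * w}).indicator
        (fun s => ENNReal.ofReal ((2 ^ n * w) ^ (-(1 + q))) * ENNReal.ofReal (ω s)) s ≤
        ENNReal.ofReal (2 * ((2:ℝ) ^ (-q)) ^ n * w ^ (-q)) := fun n => by
      rw [setLIntegral_indicator (measurableSet_sublevel_omegaHat hω _),
        inter_eq_left.2 inter_subset_left, lintegral_const_mul' _ _ ENNReal.ofReal_ne_top]
      refine (mul_le_mul_right (lintegral_sublevel_omegaHat_le hω (by positivity)) _).trans_eq ?_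
      rw [← ENNReal.ofReal_mul (by positivity)]
      congr 1
      rw [Real.mul_rpow (by positivity) hw.le, ← Real.rpow_natCast_mul (by norm_num),
        ← Real.rpow_mul_natCast (by norm_num), neg_add, Real.rpow_add hw, mul_add, 
        Real.rpow_add two_pos, Real.rpow_neg_one, mul_neg_one, Real.rpow_neg two_pos.le,
        Real.rpow_natCast, pow_succ, mul_comm (-q)]
      field_simp
    refine (ENNReal.tsum_le_tsum hn).trans_eq ?_
    rw [← tsum_mul_right, ENNReal.ofReal_tsum_of_nonneg]
    · intro n; positivity
    · exact (hgeo.mul_left 2).mul_right _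
  · intro n
    exact ((aemeasurable_ofReal_weight hω).const_mul _).indicator
      (measurableSet_sublevel_omegaHat hω _)

theorem integrableOn_pow_mul_weight {ω : ℝ → ℝ} (hω : IsRadialWeight ω) {a : ℝ} (ha : 0 ≤ a)
    (k : ℕ) : IntegrableOn (fun s => s ^ k * (ω s * omegaHat ω s ^ a)) (Ioo 0 1) := by
  have h1 : IntegrableOn ω (Icc 0 1) := (integrableOn_Icc_iff_integrableOn_Ico (by simp)).2 hω.2
  have h2 : ContinuousOn (fun s => omegaHat ω s ^ a) (Icc 0 1) :=
    (continuousOn_omegaHat hω).rpow_const fun _ _ => Or.inr ha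
  have h3 : ContinuousOn (fun s : ℝ => s ^ k) (Icc 0 1) := by fun_prop
  exact ((h1.mul_continuousOn h2 isCompact_Icc).continuousOn_mul h3 isCompact_Icc).mono_set
    Ioo_subset_Icc_self

theorem momentCoeff_eq (ω : ℝ → ℝ) (a : ℝ) (k : ℕ) :
    momentCoeff (fun r => ω r * omegaHat ω r ^ a) k =
      ∫ s in Ioo (0:ℝ) 1, s ^ (2 * k + 1) * (ω s * omegaHat ω s ^ a) := by
  rw [momentCoeff, momentW, intervalIntegral.integral_of_le zero_le_one,
    integral_Ioc_eq_integral_Ioo]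
  congr 1; funext s
  rw [show (2 * (k:ℝ) + 1) = ((2 * k + 1 : ℕ) : ℝ) by push_cast; ring, Real.rpow_natCast]

theorem weight_nonneg {ω : ℝ → ℝ} (hω : IsRadialWeight ω) (a : ℝ) {s : ℝ}
    (hs : s ∈ Ioo (0:ℝ) 1) : 0 ≤ ω s * omegaHat ω s ^ a :=
  mul_nonneg (hω.1 s ⟨hs.1.le, hs.2⟩)
    (Real.rpow_nonneg (omegaHat_nonneg hω ⟨hs.1.le, hs.2.le⟩) _)

theorem antitone_momentCoeff {ω : ℝ → ℝ} (hω : IsRadialWeight ω) {a : ℝ} (ha : 0 ≤ a) :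
    Antitone (momentCoeff fun r => ω r * omegaHat ω r ^ a) := by
  refine antitone_nat_of_succ_le fun k => ?_
  rw [momentCoeff_eq, momentCoeff_eq]
  refine setIntegral_mono_on (integrableOn_pow_mul_weight hω ha _)
    (integrableOn_pow_mul_weight hω ha _) measurableSet_Ioo fun s hs => ?_
  refine mul_le_mul_of_nonneg_right ?_ (weight_nonneg hω a hs)
  exact pow_le_pow_of_le_one hs.1.le hs.2.le (by omega)

theorem le_momentCoeff {ω : ℝ → ℝ} (hω : IsRadialWeight ω) {a : ℝ} (ha : 0 ≤ a) {y : ℝ}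
    (hy : y ∈ Ioo (0:ℝ) 1) (hWy : 0 < omegaHat ω y) (k : ℕ) :
    y ^ (2 * k + 1) * (omegaHat ω y / 2) ^ (1 + a) ≤
      momentCoeff (fun r => ω r * omegaHat ω r ^ a) k := by
  obtain ⟨t, ht, hWt⟩ := exists_omegaHat_eq hω (r := y) (t := omegaHat ω y / 2)
    ⟨hy.1.le, hy.2.le⟩ (by positivity) (by linarith)
  have hsub : Ioo y t ⊆ Ioo 0 1 := Ioo_subset_Ioo hy.1.le ht.2
  have hint : ∫ s in Ioo y t, ω s = omegaHat ω y / 2 := by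
    rw [← integral_Ioc_eq_integral_Ioo, ← intervalIntegral.integral_of_le ht.1,
      ← omegaHat_sub hω ⟨hy.1.le, hy.2.le⟩ ⟨hy.1.le.trans ht.1, ht.2⟩, hWt]
    ring
  rw [momentCoeff_eq]
  calc y ^ (2 * k + 1) * (omegaHat ω y / 2) ^ (1 + a)
      = ∫ s in Ioo y t, y ^ (2 * k + 1) * (omegaHat ω y / 2) ^ a * ω s := by
        rw [integral_const_mul, hint, Real.rpow_add (by positivity), Real.rpow_one]
        ring
    _ ≤ ∫ s in Ioo y t, s ^ (2 * k + 1) * (ω s * omegaHat ω s ^ a) := by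
        refine setIntegral_mono_on ((hω.integrableOn_Ioo.mono_set hsub).const_mul _)
          ((integrableOn_pow_mul_weight hω ha _).mono_set hsub) measurableSet_Ioo fun s hs => ?_
        have hs' := hsub hs
        have h1 : omegaHat ω y / 2 ≤ omegaHat ω s := hWt ▸
          antitoneOn_omegaHat hω ⟨hs'.1.le, hs'.2.le⟩ ⟨hy.1.le.trans ht.1, ht.2⟩ hs.2.le
        have h2 : (omegaHat ω y / 2) ^ a ≤ omegaHat ω s ^ a :=
          Real.rpow_le_rpow (by positivity) h1 ha
        have h3 : y ^ (2 * k + 1) ≤ s ^ (2 * k + 1) := pow_le_pow_left₀ hy.1.le hs.1.le _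
        rw [mul_comm (ω s), ← mul_assoc]
        refine mul_le_mul_of_nonneg_right ?_ (hω.1 s ⟨hs'.1.le, hs'.2⟩)
        exact mul_le_mul h3 h2 (by positivity) (pow_nonneg hs'.1.le _)
    _ ≤ _ := by
        refine setIntegral_mono_set (integrableOn_pow_mul_weight hω ha _) ?_
          hsub.eventuallyLE
        filter_upwards [ae_restrict_mem measurableSet_Ioo] with s hs
        exact mul_nonneg (pow_nonneg hs.1.le _) (weight_nonneg hω a hs)

theorem momentCoeff_pos {ω : ℝ → ℝ} (hω : IsRadialWeight ω)
    (hpos : ∀ r ∈ Ico (0:ℝ) 1, 0 < omegaHat ω r) {a : ℝ} (ha : 0 ≤ a) (k : ℕ) :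
    0 < momentCoeff (fun r => ω r * omegaHat ω r ^ a) k := by
  have hW := hpos (1/2) (by norm_num)
  refine lt_of_lt_of_le ?_ (le_momentCoeff hω ha (y := 1/2) (by norm_num) hW k)
  positivity

/-- The lower bound on moments that the multiplier theorem consumes. -/
theorem pow_le_momentCoeff {ω : ℝ → ℝ} (hω : IsRadialWeight ω)
    (hpos : ∀ r ∈ Ico (0:ℝ) 1, 0 < omegaHat ω r) {C : ℝ} (hC : 0 < C)
    (hD : ∀ r ∈ Ico (0:ℝ) 1, omegaHat ω r ≤ C * omegaHat ω ((1 + r) / 2))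
    {a : ℝ} (ha : 0 ≤ a) {x : ℝ} (hx : x ∈ Ico (0:ℝ) 1) (k : ℕ) :
    ((3 + x) / 4) ^ (2 * k) ≤ 4 / 3 * (2 * C ^ 2 / omegaHat ω x) ^ (1 + a) *
      momentCoeff (fun r => ω r * omegaHat ω r ^ a) k := by
  have hy : (3 + x) / 4 ∈ Ioo (0:ℝ) 1 := by
    constructor <;> linarith [hx.1, hx.2]
  have h1 : omegaHat ω x ≤ C ^ 2 * omegaHat ω ((3 + x) / 4) := by
    have h1 := hD x hx
    have h2 := hD ((1 + x) / 2) ⟨by linarith [hx.1], by linarith [hx.2]⟩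
    rw [show (1 + (1 + x) / 2) / 2 = (3 + x) / 4 by ring] at h2
    calc _ ≤ _ := h1
      _ ≤ C * (C * omegaHat ω ((3 + x) / 4)) := by gcongr
      _ = _ := by ring
  have hWx := hpos x hx
  have hWy := hpos _ ⟨hy.1.le, hy.2⟩
  have h2 := le_momentCoeff hω ha hy hWy k
  set y := (3 + x) / 4 with hyx
  have hy' : 3 / 4 ≤ y := by rw [hyx]; linarith [hx.1]
  have hq : 1 ≤ (2 * C ^ 2 / omegaHat ω x) ^ (1 + a) * (omegaHat ω y / 2) ^ (1 + a) := by
    rw [← Real.mul_rpow (by positivity) (by positivity)]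
    refine Real.one_le_rpow ?_ (by linarith)
    rw [div_mul_div_comm, one_le_div (by positivity)]
    linarith
  have hyk : 0 ≤ y ^ (2 * k) := pow_nonneg hy.1.le _
  calc y ^ (2 * k) ≤ (4 / 3 * y) * y ^ (2 * k) *
        ((2 * C ^ 2 / omegaHat ω x) ^ (1 + a) * (omegaHat ω y / 2) ^ (1 + a)) := by
        have h3 : 1 ≤ 4 / 3 * y := by linarith
        have h4 : y ^ (2 * k) ≤ 4 / 3 * y * y ^ (2 * k) := le_mul_of_one_le_left hyk h3
        exact h4.trans (le_mul_of_one_le_right (hyk.trans h4) hq)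
    _ = 4 / 3 * (2 * C ^ 2 / omegaHat ω x) ^ (1 + a) *
        (y ^ (2 * k + 1) * (omegaHat ω y / 2) ^ (1 + a)) := by ring
    _ ≤ _ := by gcongr

/-- Integral means of order `p`, as real numbers. -/
def meanN (p : ℝ) (f : ℂ → ℂ) (r : ℝ) : ℝ := cnorm p fun θ => f (circlePt r θ)

theorem meanN_nonneg (p : ℝ) (f : ℂ → ℂ) (r : ℝ) : 0 ≤ meanN p f r := cnorm_nonneg _ _

theorem MpE_eq_ofReal {p : ℝ} (hp : 0 < p) {f : ℂ → ℂ}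
    (hf : DifferentiableOn ℂ f (Metric.ball 0 1)) {r : ℝ} (hr : r ∈ Ico (0:ℝ) 1) :
    MpE p r f = ENNReal.ofReal (meanN p f r) := by
  rw [MpE_eq_eLpNorm hp, meanN, ofReal_cnorm (continuous_comp_circlePt hf hr)]

theorem monotoneOn_meanN {p : ℝ} (hp : 1 < p) {f : ℂ → ℂ}
    (hf : DifferentiableOn ℂ f (Metric.ball 0 1)) : MonotoneOn (meanN p f) (Ico 0 1) :=
  fun _ hr _ hR h => cnorm_circlePt_mono hp hf hr.1 h hR.2

theorem aemeasurable_meanN {p : ℝ} (hp : 1 < p) {f : ℂ → ℂ}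
    (hf : DifferentiableOn ℂ f (Metric.ball 0 1)) :
    AEMeasurable (meanN p f) (volume.restrict (Ioo 0 1)) :=
  aemeasurable_restrict_of_monotoneOn measurableSet_Ioo
    ((monotoneOn_meanN hp hf).mono Ioo_subset_Ico_self)

theorem aestronglyMeasurable_norm_integrand {ω : ℝ → ℝ} (hω : IsRadialWeight ω) {p : ℝ}
    (hp : 1 < p) (q : ℝ) {f : ℂ → ℂ} (hf : DifferentiableOn ℂ f (Metric.ball 0 1)) :
    AEStronglyMeasurable (fun r => meanN p f r ^ q * (r * ω r)) (volume.restrict (Ioo 0 1)) :=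
  (((aemeasurable_meanN hp hf).pow_const q).mul
    (aemeasurable_id.mul hω.integrableOn_Ioo.aestronglyMeasurable.aemeasurable)
      ).aestronglyMeasurable

theorem norm_integrand_nonneg {ω : ℝ → ℝ} (hω : IsRadialWeight ω) (p q : ℝ) (f : ℂ → ℂ) {r : ℝ}
    (hr : r ∈ Ioo (0:ℝ) 1) : 0 ≤ meanN p f r ^ q * (r * ω r) :=
  mul_nonneg (Real.rpow_nonneg (meanN_nonneg _ _ _) _) (mul_nonneg hr.1.le
    (hω.1 r ⟨hr.1.le, hr.2⟩))

theorem LpqNormE_eq {ω : ℝ → ℝ} {p q : ℝ} (hp : 0 < p) (hq : 0 < q)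
    {f : ℂ → ℂ} (hf : DifferentiableOn ℂ f (Metric.ball 0 1)) :
    LpqNormE ω p q f =
      (∫⁻ r in Ioo (0:ℝ) 1, ENNReal.ofReal (meanN p f r ^ q * (r * ω r))) ^ (1 / q) := by
  rw [LpqNormE]
  congr 1
  refine setLIntegral_congr_fun measurableSet_Ioo fun r hr => ?_
  rw [MpE_eq_ofReal hp hf ⟨hr.1.le, hr.2⟩, ENNReal.ofReal_rpow_of_nonneg (meanN_nonneg _ _ _) hq.le,
    ← ENNReal.ofReal_mul (Real.rpow_nonneg (meanN_nonneg _ _ _) _)]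

theorem inApq_of_lintegral_le {ω : ℝ → ℝ} {p q : ℝ} (hp : 0 < p) (hq : 0 < q) {f : ℂ → ℂ}
    (hf : DifferentiableOn ℂ f (Metric.ball 0 1)) {B : ℝ}
    (h : ∫⁻ r in Ioo (0:ℝ) 1, ENNReal.ofReal (meanN p f r ^ q * (r * ω r)) ≤ ENNReal.ofReal B) :
    InApq ω p q f := by
  refine ⟨hf, ?_⟩
  rw [LpqNormE_eq hp hq hf]
  exact ENNReal.rpow_lt_top_of_nonneg (by positivity) (h.trans_lt ENNReal.ofReal_lt_top).ne

theorem LpqNormE_toReal_le_of_lintegral_le {ω : ℝ → ℝ} {p q : ℝ} (hp : 0 < p) (hq : 0 < q)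
    {f : ℂ → ℂ} (hf : DifferentiableOn ℂ f (Metric.ball 0 1)) {B : ℝ} (hB : 0 ≤ B)
    (h : ∫⁻ r in Ioo (0:ℝ) 1, ENNReal.ofReal (meanN p f r ^ q * (r * ω r)) ≤ ENNReal.ofReal B) :
    (LpqNormE ω p q f).toReal ≤ B ^ (1 / q) := by
  rw [LpqNormE_eq hp hq hf]
  refine ENNReal.toReal_le_of_le_ofReal (Real.rpow_nonneg hB _) ?_
  rw [← ENNReal.ofReal_rpow_of_nonneg hB (by positivity)]
  exact ENNReal.rpow_le_rpow h (by positivity)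

theorem InApq.integrableOn {ω : ℝ → ℝ} (hω : IsRadialWeight ω) {p q : ℝ} (hp : 1 < p) (hq : 0 < q)
    {f : ℂ → ℂ} (hf : InApq ω p q f) :
    IntegrableOn (fun r => meanN p f r ^ q * (r * ω r)) (Ioo 0 1) := by
  refine ⟨aestronglyMeasurable_norm_integrand hω hp q hf.1, ?_⟩
  rw [hasFiniteIntegral_iff_ofReal]
  · have := hf.2
    rw [LpqNormE_eq (by linarith) hq hf.1, ENNReal.rpow_lt_top_iff_of_pos (by positivity)] at this
    exact this
  · filter_upwards [ae_restrict_mem measurableSet_Ioo] with r hr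
    exact norm_integrand_nonneg hω p q f hr

theorem InApq.norm_rpow {ω : ℝ → ℝ} (hω : IsRadialWeight ω) {p q : ℝ} (hp : 1 < p) (hq : 0 < q)
    {f : ℂ → ℂ} (hf : InApq ω p q f) :
    (LpqNormE ω p q f).toReal ^ q = ∫ r in Ioo (0:ℝ) 1, meanN p f r ^ q * (r * ω r) := by
  have h0 : 0 ≤ᵐ[volume.restrict (Ioo (0:ℝ) 1)] fun r => meanN p f r ^ q * (r * ω r) := by
    filter_upwards [ae_restrict_mem measurableSet_Ioo] with r hr
    exact norm_integrand_nonneg hω p q f hr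
  rw [LpqNormE_eq (by linarith) hq hf.1,
    ← ofReal_integral_eq_lintegral_ofReal (hf.integrableOn hω hp hq) h0, ← ENNReal.toReal_rpow,
    ENNReal.toReal_ofReal (integral_nonneg_of_ae h0),
    ← Real.rpow_mul (integral_nonneg_of_ae h0), one_div_mul_cancel hq.ne', Real.rpow_one]

theorem meanN_rpow_mul_omegaHat_le {ω : ℝ → ℝ} (hω : IsRadialWeight ω) {C : ℝ} (hC : 0 < C)
    (hD : ∀ r ∈ Ico (0:ℝ) 1, omegaHat ω r ≤ C * omegaHat ω ((1 + r) / 2))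
    {p q : ℝ} (hp : 1 < p) (hq : 0 < q) {f : ℂ → ℂ} (hf : InApq ω p q f) {s : ℝ}
    (hs : s ∈ Ico (0:ℝ) 1) :
    meanN p f s ^ q * omegaHat ω s ≤ 2 * C * (LpqNormE ω p q f).toReal ^ q := by
  rw [hf.norm_rpow hω hp hq]
  have hi := hf.integrableOn hω hp hq
  set t := (1 + s) / 2 with ht
  have ht1 : t ∈ Icc (0:ℝ) 1 := ⟨by linarith [hs.1], by linarith [hs.2]⟩
  have hsub : Ioo t 1 ⊆ Ioo 0 1 := Ioo_subset_Ioo_left ht1.1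
  have hN := Real.rpow_nonneg (meanN_nonneg p f s) q
  have h1 : ∫ r in Ioo t 1, meanN p f s ^ q * (1 / 2) * ω r ≤
      ∫ r in Ioo t 1, meanN p f r ^ q * (r * ω r) := by
    refine setIntegral_mono_on ((hω.integrableOn_Ioo.mono_set hsub).const_mul _)
      (hi.mono_set hsub) measurableSet_Ioo fun r hr => ?_
    have hr' := hsub hr
    rw [← mul_assoc]
    refine mul_le_mul_of_nonneg_right ?_ (hω.1 r ⟨hr'.1.le, hr'.2⟩)
    refine mul_le_mul ?_ (by linarith [hr.1, hs.1]) (by norm_num)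
      (Real.rpow_nonneg (meanN_nonneg _ _ _) _)
    refine Real.rpow_le_rpow (meanN_nonneg _ _ _) ?_ hq.le
    exact monotoneOn_meanN hp hf.1 hs ⟨hr'.1.le, hr'.2⟩ (by linarith [hr.1, hs.2])
  have h2 : ∫ r in Ioo t 1, meanN p f r ^ q * (r * ω r) ≤
      ∫ r in Ioo (0:ℝ) 1, meanN p f r ^ q * (r * ω r) := by
    refine setIntegral_mono_set hi ?_ hsub.eventuallyLE
    filter_upwards [ae_restrict_mem measurableSet_Ioo] with r hr
    exact norm_integrand_nonneg hω p q f hr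
  have h3 : ∫ r in Ioo t 1, ω r = omegaHat ω t := by
    rw [omegaHat, intervalIntegral.integral_of_le ht1.2, integral_Ioc_eq_integral_Ioo]
  rw [integral_const_mul, h3] at h1
  calc meanN p f s ^ q * omegaHat ω s ≤ meanN p f s ^ q * (C * omegaHat ω t) := by
        gcongr; exact hD s hs
    _ = 2 * C * (meanN p f s ^ q * (1 / 2) * omegaHat ω t) := by ring
    _ ≤ _ := by gcongr; exact h1.trans h2

theorem meanN_mul_omegaHat_le_ApInfNormE {ω : ℝ → ℝ} {p : ℝ} (hp : 0 < p) {g : ℂ → ℂ}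
    (hg : InApInf ω p g) {r : ℝ} (hr : r ∈ Ico (0:ℝ) 1) :
    meanN p g r * omegaHat ω r ≤ (ApInfNormE ω p g).toReal := by
  have h : MpE p r g * ENNReal.ofReal (omegaHat ω r) ≤ ApInfNormE ω p g :=
    le_iSup₂ (f := fun r (_ : r ∈ Ico (0:ℝ) 1) => MpE p r g * ENNReal.ofReal (omegaHat ω r)) r hr
  rw [MpE_eq_ofReal hp hg.1 hr, ← ENNReal.ofReal_mul (meanN_nonneg _ _ _)] at h
  exact (ENNReal.ofReal_le_iff_le_toReal hg.2.ne).1 h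

/-- The Hadamard-type product `∑ f̂(k) conj(ĝ(k)) z^k`. -/
def conjHadamard (f g : ℂ → ℂ) (z : ℂ) : ℂ :=
  ∑' k : ℕ, taylorCoeff f k * (starRingEnd ℂ) (taylorCoeff g k) * z ^ k

theorem summable_conjHadamard {f g : ℂ → ℂ} (hf : DifferentiableOn ℂ f (Metric.ball 0 1))
    (hg : DifferentiableOn ℂ g (Metric.ball 0 1)) {r : ℝ} (hr : r ∈ Ico (0:ℝ) 1) :
    Summable fun k => ‖taylorCoeff f k * (starRingEnd ℂ) (taylorCoeff g k)‖ * r ^ k := by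
  have hs : √r ∈ Ico (0:ℝ) 1 := ⟨Real.sqrt_nonneg _, by
    rw [Real.sqrt_lt' one_pos]; simpa using hr.2⟩
  have := (hasSum_integral_mul_conj hf hg hs).summable.norm
  simpa [pow_mul, abs_of_nonneg (Real.sqrt_nonneg r), Real.sq_sqrt hr.1] using this

theorem norm_conjHadamard_sq_le {f g : ℂ → ℂ} (hf : DifferentiableOn ℂ f (Metric.ball 0 1))
    (hg : DifferentiableOn ℂ g (Metric.ball 0 1)) {p p' : ℝ} (hpp : p.HolderConjugate p')
    {s : ℝ} (hs : s ∈ Ico (0:ℝ) 1) :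
    ‖conjHadamard f g ((s ^ 2 : ℝ) : ℂ)‖ ≤ meanN p f s * meanN p' g s := by
  have h : conjHadamard f g ((s ^ 2 : ℝ) : ℂ) =
      ∫ θ, f (circlePt s θ) * (starRingEnd ℂ) (g (circlePt s θ)) ∂circMeas := by
    rw [← (hasSum_integral_mul_conj hf hg hs).tsum_eq, conjHadamard]
    simp only [Complex.ofReal_pow, pow_mul]
  rw [h]
  refine (norm_integral_mul_le_cnorm hpp (continuous_comp_circlePt hf hs)
    (ψ := fun θ => (starRingEnd ℂ) (g (circlePt s θ)))
    (Complex.continuous_conj.comp (continuous_comp_circlePt hg hs))).trans_eq ?_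
  rw [meanN, meanN, cnorm_congr_norm p' (φ := fun θ => (starRingEnd ℂ) (g (circlePt s θ)))
    (ψ := fun θ => g (circlePt s θ)) fun θ => by simp]

theorem hasSum_pairing {ω : ℝ → ℝ} (hω : IsRadialWeight ω) {a : ℝ} (ha : 0 ≤ a)
    {f g : ℂ → ℂ} (hf : DifferentiableOn ℂ f (Metric.ball 0 1))
    (hg : DifferentiableOn ℂ g (Metric.ball 0 1)) {r : ℝ} (hr : r ∈ Ico (0:ℝ) 1) :
    HasSum (fun k : ℕ => taylorCoeff f k * (starRingEnd ℂ) (taylorCoeff g k) *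
        ((momentCoeff (fun r => ω r * omegaHat ω r ^ a) k : ℝ) : ℂ) * (r:ℂ) ^ k)
      (∫ s in Ioo (0:ℝ) 1, ((s * (ω s * omegaHat ω s ^ a) : ℝ) : ℂ) *
        conjHadamard f g ((s ^ 2 * r : ℝ) : ℂ)) := by
  set u : ℕ → ℂ := fun k => taylorCoeff f k * (starRingEnd ℂ) (taylorCoeff g k) with hu
  have hi : ∀ k : ℕ, Integrable (fun s : ℝ => u k * (r:ℂ) ^ k *
      ((s ^ (2 * k + 1) * (ω s * omegaHat ω s ^ a) : ℝ) : ℂ)) (volume.restrict (Ioo 0 1)) :=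
    fun k => ((integrableOn_pow_mul_weight hω ha (2 * k + 1)).ofReal).const_mul _
  have hn : ∀ k : ℕ, ∫ s in Ioo (0:ℝ) 1, ‖u k * (r:ℂ) ^ k *
      ((s ^ (2 * k + 1) * (ω s * omegaHat ω s ^ a) : ℝ) : ℂ)‖ =
      ‖u k‖ * r ^ k * momentCoeff (fun r => ω r * omegaHat ω r ^ a) k := fun k => by
    rw [momentCoeff_eq, ← integral_const_mul]
    refine setIntegral_congr_fun measurableSet_Ioo fun s hs => ?_
    rw [norm_mul, norm_mul, norm_pow, Complex.norm_real, Complex.norm_real,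
      Real.norm_of_nonneg hr.1,
      Real.norm_of_nonneg (mul_nonneg (pow_nonneg hs.1.le _) (weight_nonneg hω a hs))]
  have hsum := hasSum_integral_of_summable_integral_norm hi (by
    simp only [hn]
    refine Summable.of_nonneg_of_le (fun k => ?_) (fun k => ?_)
      ((summable_conjHadamard hf hg hr).mul_right
        (momentCoeff (fun r => ω r * omegaHat ω r ^ a) 0))
    · rw [← hn]; exact integral_nonneg fun s => norm_nonneg _
    · exact mul_le_mul_of_nonneg_left (antitone_momentCoeff hω ha (Nat.zero_le k))
        (mul_nonneg (norm_nonneg _) (pow_nonneg hr.1 _)))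
  have e1 : (fun k : ℕ => taylorCoeff f k * (starRingEnd ℂ) (taylorCoeff g k) *
      ((momentCoeff (fun r => ω r * omegaHat ω r ^ a) k : ℝ) : ℂ) * (r:ℂ) ^ k) =
      fun k : ℕ => ∫ s in Ioo (0:ℝ) 1,
        u k * (r:ℂ) ^ k * ((s ^ (2 * k + 1) * (ω s * omegaHat ω s ^ a) : ℝ) : ℂ) := by
    funext k
    rw [integral_const_mul, integral_complex_ofReal, ← momentCoeff_eq]
    ring
  have e2 : ∫ s in Ioo (0:ℝ) 1, ((s * (ω s * omegaHat ω s ^ a) : ℝ) : ℂ) *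
      conjHadamard f g ((s ^ 2 * r : ℝ) : ℂ) = ∫ s in Ioo (0:ℝ) 1, ∑' k : ℕ,
        u k * (r:ℂ) ^ k * ((s ^ (2 * k + 1) * (ω s * omegaHat ω s ^ a) : ℝ) : ℂ) := by
    refine setIntegral_congr_fun measurableSet_Ioo fun s hs => ?_
    rw [conjHadamard, ← tsum_mul_left]
    congr 1; funext k
    simp only [hu]
    push_cast
    ring
  rw [e1, e2]
  exact hsum

theorem norm_pairing_integrand_le {ω : ℝ → ℝ} (hω : IsRadialWeight ω)
    (hpos : ∀ r ∈ Ico (0:ℝ) 1, 0 < omegaHat ω r) {C : ℝ} (hC : 0 < C)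
    (hD : ∀ r ∈ Ico (0:ℝ) 1, omegaHat ω r ≤ C * omegaHat ω ((1 + r) / 2))
    {p q p' : ℝ} (hpp : p.HolderConjugate p') (hq0 : 0 < q) (hq1 : q ≤ 1) {f g : ℂ → ℂ}
    (hf : InApq ω p q f) (hg : InApInf ω p' g) {r : ℝ} (hr : r ∈ Icc (0:ℝ) 1) {s : ℝ}
    (hs : s ∈ Ioo (0:ℝ) 1) :
    ‖((s * (ω s * omegaHat ω s ^ (1 / q)) : ℝ) : ℂ) * conjHadamard f g ((s ^ 2 * r : ℝ) : ℂ)‖ ≤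
      (ApInfNormE ω p' g).toReal * ((2 * C) ^ (1 / q) * (LpqNormE ω p q f).toReal) ^ (1 - q) *
        (meanN p f s ^ q * (s * ω s)) := by
  have hs' : s ∈ Ico (0:ℝ) 1 := ⟨hs.1.le, hs.2⟩
  have hW := hpos s hs'
  have hω0 := hω.1 s hs'
  set N := meanN p f s with hNdef
  set A := (LpqNormE ω p q f).toReal with hA
  set G := (ApInfNormE ω p' g).toReal with hG
  set W := omegaHat ω s with hWdef
  have hN0 : 0 ≤ N := meanN_nonneg _ _ _
  have hA0 : 0 ≤ A := ENNReal.toReal_nonneg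
  have hrs : s * √r ∈ Ico (0:ℝ) 1 := ⟨mul_nonneg hs.1.le (Real.sqrt_nonneg _), by
    have : √r ≤ 1 := Real.sqrt_le_one.2 hr.2
    nlinarith [hs.1, hs.2, Real.sqrt_nonneg r]⟩
  have hle : s * √r ≤ s := mul_le_of_le_one_right hs.1.le (Real.sqrt_le_one.2 hr.2)
  have h1 : ‖conjHadamard f g ((s ^ 2 * r : ℝ) : ℂ)‖ ≤ N * (G / W) := by
    rw [show s ^ 2 * r = (s * √r) ^ 2 by rw [mul_pow, Real.sq_sqrt hr.1]]
    refine (norm_conjHadamard_sq_le hf.1 hg.1 hpp hrs).trans ?_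
    refine mul_le_mul (monotoneOn_meanN hpp.lt hf.1 hrs hs' hle) ?_ (meanN_nonneg _ _ _) hN0
    rw [le_div_iff₀ hW]
    exact (mul_le_mul_of_nonneg_right (monotoneOn_meanN hpp.symm.lt hg.1 hrs hs' hle) hW.le).trans
      (meanN_mul_omegaHat_le_ApInfNormE hpp.symm.pos hg hs')
  have h2 : (N * W ^ (1 / q)) ^ (1 - q) ≤ ((2 * C) ^ (1 / q) * A) ^ (1 - q) := by
    refine Real.rpow_le_rpow (by positivity) ?_ (by linarith)
    have h3 := Real.rpow_le_rpow (by positivity)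
      (meanN_rpow_mul_omegaHat_le hω hC hD hpp.lt hq0 hf hs') (z := 1 / q) (by positivity)
    rwa [Real.mul_rpow (by positivity) hW.le, Real.mul_rpow (by positivity) (by positivity),
      ← Real.rpow_mul hN0, ← Real.rpow_mul hA0, mul_one_div_cancel hq0.ne', Real.rpow_one,
      Real.rpow_one] at h3
  have h3 : W ^ (1 / q) * (N * (G / W)) = G * (N * W ^ (1 / q)) ^ (1 - q) * N ^ q := by
    rw [Real.mul_rpow hN0 (by positivity), ← Real.rpow_mul hW.le,
      show (1 / q * (1 - q)) = 1 / q - 1 by field_simp, Real.rpow_sub_one hW.ne']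
    have : N = N ^ (1 - q) * N ^ q := by
      rw [← Real.rpow_add_of_nonneg hN0 (by linarith) hq0.le, sub_add_cancel, Real.rpow_one]
    calc _ = W ^ (1 / q) * G / W * N := by ring
      _ = W ^ (1 / q) * G / W * (N ^ (1 - q) * N ^ q) := by rw [← this]
      _ = _ := by ring
  have hG0 : 0 ≤ G := ENNReal.toReal_nonneg
  rw [norm_mul, Complex.norm_real, Real.norm_of_nonneg
    (mul_nonneg hs.1.le (weight_nonneg hω _ hs))]
  have hsω : 0 ≤ s * ω s := mul_nonneg hs.1.le hω0
  calc s * (ω s * W ^ (1 / q)) * ‖conjHadamard f g ((s ^ 2 * r : ℝ) : ℂ)‖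
      ≤ s * (ω s * W ^ (1 / q)) * (N * (G / W)) :=
        mul_le_mul_of_nonneg_left h1 (mul_nonneg hs.1.le (weight_nonneg hω _ hs))
    _ = (W ^ (1 / q) * (N * (G / W))) * (s * ω s) := by ring
    _ = G * (N * W ^ (1 / q)) ^ (1 - q) * N ^ q * (s * ω s) := by rw [h3]
    _ ≤ G * ((2 * C) ^ (1 / q) * A) ^ (1 - q) * N ^ q * (s * ω s) := by gcongr
    _ = _ := by ring

theorem exists_pairing {ω : ℝ → ℝ} (hω : IsRadialWeight ω)
    (hpos : ∀ r ∈ Ico (0:ℝ) 1, 0 < omegaHat ω r) {C : ℝ} (hC : 0 < C)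
    (hD : ∀ r ∈ Ico (0:ℝ) 1, omegaHat ω r ≤ C * omegaHat ω ((1 + r) / 2))
    {p q p' : ℝ} (hpp : p.HolderConjugate p') (hq0 : 0 < q) (hq1 : q ≤ 1) {f g : ℂ → ℂ}
    (hg : InApInf ω p' g) (hf : InApq ω p q f) :
    ∃ l : ℂ, HasPairingC (momentCoeff fun r => ω r * omegaHat ω r ^ (1 / q)) f g l ∧
      ‖l‖ ≤ ((2 * C) ^ (1 / q)) ^ (1 - q) * (ApInfNormE ω p' g).toReal *
        (LpqNormE ω p q f).toReal := by
  have ha : 0 ≤ 1 / q := by positivity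
  have hb := fun (r : ℝ) (hr : r ∈ Icc (0:ℝ) 1) (s : ℝ) (hs : s ∈ Ioo (0:ℝ) 1) =>
    norm_pairing_integrand_le hω hpos hC hD hpp hq0 hq1 hf hg hr hs
  have hbi := (hf.integrableOn hω hpp.lt hq0).const_mul ((ApInfNormE ω p' g).toReal *
    ((2 * C) ^ (1 / q) * (LpqNormE ω p q f).toReal) ^ (1 - q))
  have hH : DifferentiableOn ℂ (conjHadamard f g) (Metric.ball 0 1) :=
    differentiableOn_tsum_pow fun r hr => summable_conjHadamard hf.1 hg.1 hr
  have hball : ∀ s ∈ Ioo (0:ℝ) 1, ∀ r ∈ Icc (0:ℝ) 1,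
      ((s ^ 2 * r : ℝ) : ℂ) ∈ Metric.ball (0:ℂ) 1 := fun s hs r hr => by
    rw [mem_ball_zero_iff, Complex.norm_real,
      Real.norm_of_nonneg (mul_nonneg (sq_nonneg _) hr.1)]
    nlinarith [hs.1, hs.2, hr.1, hr.2, mul_le_of_le_one_right (sq_nonneg s) hr.2]
  refine ⟨∫ s in Ioo (0:ℝ) 1, ((s * (ω s * omegaHat ω s ^ (1 / q)) : ℝ) : ℂ) *
    conjHadamard f g ((s ^ 2 * 1 : ℝ) : ℂ),
    ⟨fun r hr => (hasSum_pairing hω ha hf.1 hg.1 hr).summable, ?_⟩, ?_⟩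
  · have hev : ∀ᶠ r : ℝ in nhdsWithin 1 (Iio 1), r ∈ Ico (0:ℝ) 1 := by
      filter_upwards [Ioo_mem_nhdsLT (zero_lt_one' ℝ)] with r hr
      exact ⟨hr.1.le, hr.2⟩
    refine Tendsto.congr' (hev.mono fun r hr => (hasSum_pairing hω ha hf.1 hg.1 hr).tsum_eq.symm) ?_
    refine tendsto_integral_filter_of_dominated_convergence _ ?_ ?_ hbi ?_
    · refine hev.mono fun r hr => ?_
      have h1 := (integrableOn_pow_mul_weight hω ha 1).ofReal (𝕜 := ℂ)
      simp only [pow_one] at h1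
      refine h1.aestronglyMeasurable.mul (ContinuousOn.aestronglyMeasurable ?_ measurableSet_Ioo)
      exact hH.continuousOn.comp (by fun_prop) fun s hs => hball s hs r ⟨hr.1, hr.2.le⟩
    · refine hev.mono fun r hr => ?_
      filter_upwards [ae_restrict_mem measurableSet_Ioo] with s hs
      exact hb r ⟨hr.1, hr.2.le⟩ s hs
    · filter_upwards [ae_restrict_mem measurableSet_Ioo] with s hs
      refine Tendsto.const_mul _ ?_
      have hc : ContinuousAt (conjHadamard f g) ((s ^ 2 * 1 : ℝ) : ℂ) :=
        (hH.differentiableAt (Metric.isOpen_ball.mem_nhds (hball s hs 1 (by simp)))).continuousAt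
      have : ContinuousAt (fun r : ℝ => conjHadamard f g ((s ^ 2 * r : ℝ) : ℂ)) 1 :=
        hc.comp (f := fun r : ℝ => ((s ^ 2 * r : ℝ) : ℂ)) (by fun_prop)
      exact this.tendsto.mono_left nhdsWithin_le_nhds
  · refine (norm_integral_le_of_norm_le hbi ?_).trans_eq ?_
    · filter_upwards [ae_restrict_mem measurableSet_Ioo] with s hs
      exact hb 1 (by simp) s hs
    · rw [integral_const_mul, ← hf.norm_rpow hω hpp.lt hq0,
        Real.mul_rpow (by positivity) ENNReal.toReal_nonneg]
      have : (LpqNormE ω p q f).toReal ^ (1 - q) * (LpqNormE ω p q f).toReal ^ q =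
          (LpqNormE ω p q f).toReal := by
        rw [← Real.rpow_add_of_nonneg ENNReal.toReal_nonneg (by linarith) hq0.le, sub_add_cancel,
          Real.rpow_one]
      calc _ = ((2 * C) ^ (1 / q)) ^ (1 - q) * (ApInfNormE ω p' g).toReal *
          ((LpqNormE ω p q f).toReal ^ (1 - q) * (LpqNormE ω p q f).toReal ^ q) := by ring
        _ = _ := by rw [this]

theorem inApq_of_bound {ω : ℝ → ℝ} (hω : IsRadialWeight ω) {p q : ℝ} (hp : 0 < p) (hq : 0 < q)
    {f : ℂ → ℂ} (hf : DifferentiableOn ℂ f (Metric.ball 0 1)) {B : ℝ}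
    (hB : ∀ z ∈ Metric.ball (0:ℂ) 1, ‖f z‖ ≤ B) :
    InApq ω p q f ∧ (LpqNormE ω p q f).toReal ≤ B * omegaHat ω 0 ^ (1 / q) := by
  have hB0 : 0 ≤ B := (norm_nonneg _).trans (hB 0 (by simp))
  have hW : 0 ≤ omegaHat ω 0 := omegaHat_nonneg hω (by simp)
  have h : ∫⁻ r in Ioo (0:ℝ) 1, ENNReal.ofReal (meanN p f r ^ q * (r * ω r)) ≤
      ENNReal.ofReal (B ^ q * omegaHat ω 0) := by
    rw [ENNReal.ofReal_mul (by positivity), ← lintegral_Ioo_eq_omegaHat hω (by simp),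
      ← lintegral_const_mul' _ _ ENNReal.ofReal_ne_top]
    refine setLIntegral_mono' measurableSet_Ioo fun r hr => ?_
    rw [← ENNReal.ofReal_mul (by positivity)]
    refine ENNReal.ofReal_le_ofReal ?_
    have hr' : r ∈ Ico (0:ℝ) 1 := ⟨hr.1.le, hr.2⟩
    have h1 : meanN p f r ≤ B := cnorm_le_of_bound fun θ => hB _ (circlePt_mem_ball hr' θ)
    have h2 := hω.1 r hr'
    exact mul_le_mul (Real.rpow_le_rpow (meanN_nonneg _ _ _) h1 hq.le)
      (mul_le_of_le_one_left h2 hr.2.le) (mul_nonneg hr.1.le h2) (by positivity)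
  refine ⟨inApq_of_lintegral_le hp hq hf h, ?_⟩
  refine (LpqNormE_toReal_le_of_lintegral_le hp hq hf (by positivity) h).trans_eq ?_
  rw [Real.mul_rpow (by positivity) hW, ← Real.rpow_mul hB0, mul_one_div_cancel hq.ne',
    Real.rpow_one]

theorem inApq_pow {ω : ℝ → ℝ} (hω : IsRadialWeight ω) {p q : ℝ} (hp : 0 < p) (hq : 0 < q) (k : ℕ) :
    InApq ω p q (fun z => z ^ k) ∧
      (LpqNormE ω p q fun z => z ^ k).toReal ≤ omegaHat ω 0 ^ (1 / q) := by
  have := inApq_of_bound hω hp hq (f := fun z => z ^ k) (by fun_prop) (B := 1) fun z hz => by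
    rw [norm_pow]
    exact pow_le_one₀ (norm_nonneg _) (mem_ball_zero_iff.1 hz).le
  rwa [one_mul] at this

theorem inApq_sum_pow {ω : ℝ → ℝ} (hω : IsRadialWeight ω) {p q : ℝ} (hp : 0 < p) (hq : 0 < q)
    (a : ℕ → ℂ) (n : ℕ) : InApq ω p q (fun z => ∑ k ∈ Finset.range n, a k * z ^ k) := by
  refine (inApq_of_bound hω hp hq (by fun_prop) (B := ∑ k ∈ Finset.range n, ‖a k‖)
    fun z hz => (norm_sum_le _ _).trans (Finset.sum_le_sum fun k _ => ?_)).1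
  rw [norm_mul, norm_pow]
  exact mul_le_of_le_one_right (norm_nonneg _)
    (pow_le_one₀ (norm_nonneg _) (mem_ball_zero_iff.1 hz).le)

theorem IsLinearOn.map_sum_pow {ω : ℝ → ℝ} (hω : IsRadialWeight ω) {p q : ℝ} (hp : 0 < p)
    (hq : 0 < q) {L : (ℂ → ℂ) → ℂ} (hL : IsLinearOn (InApq ω p q) L) (a : ℕ → ℂ) (n : ℕ) :
    L (fun z => ∑ k ∈ Finset.range n, a k * z ^ k) =
      ∑ k ∈ Finset.range n, a k * L (fun z => z ^ k) := by
  induction n with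
  | zero =>
    have := hL.2 0 _ (inApq_sum_pow hω hp hq a 0)
    rw [zero_mul] at this
    rw [Finset.sum_range_zero, ← this]
    congr 1; funext z; simp
  | succ n ih =>
    rw [Finset.sum_range_succ, ← ih, ← hL.2 _ _ (inApq_pow hω hp hq n).1, ← hL.1 _ _
      (inApq_sum_pow hω hp hq a n)]
    · congr 1; funext z; simp [Finset.sum_range_succ]
    · refine (inApq_of_bound hω hp hq (by fun_prop) (B := ‖a n‖) fun z hz => ?_).1
      rw [Pi.smul_apply, smul_eq_mul, norm_mul, norm_pow]
      exact mul_le_of_le_one_right (norm_nonneg _)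
        (pow_le_one₀ (norm_nonneg _) (mem_ball_zero_iff.1 hz).le)

theorem IsLinearOn.map_sub {P : (ℂ → ℂ) → Prop} {L : (ℂ → ℂ) → ℂ} (hL : IsLinearOn P L)
    {f g : ℂ → ℂ} (hg : P g) (hfg : P (f - g)) : L (f - g) = L f - L g := by
  have := hL.1 _ _ hfg hg
  rw [sub_add_cancel] at this
  rw [this, add_sub_cancel_right]

theorem differentiableOn_dilateF {f : ℂ → ℂ} (hf : DifferentiableOn ℂ f (Metric.ball 0 1))
    {r : ℝ} (hr : r ∈ Icc (0:ℝ) 1) : DifferentiableOn ℂ (dilateF f r) (Metric.ball 0 1) := by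
  refine hf.comp (by fun_prop) fun z hz => ?_
  rw [mem_ball_zero_iff] at hz ⊢
  rw [norm_mul, Complex.norm_real, Real.norm_of_nonneg hr.1]
  nlinarith [hr.1, hr.2, norm_nonneg z]

theorem norm_dilateF_sub_sum_le {f : ℂ → ℂ} (hf : DifferentiableOn ℂ f (Metric.ball 0 1))
    {r : ℝ} (hr : r ∈ Ico (0:ℝ) 1) (n : ℕ) {z : ℂ} (hz : z ∈ Metric.ball (0:ℂ) 1) :
    ‖(dilateF f r - fun z => ∑ k ∈ Finset.range n, taylorCoeff f k * (r:ℂ) ^ k * z ^ k) z‖ ≤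
      ∑' k, ‖taylorCoeff f (k + n)‖ * r ^ (k + n) := by
  rw [mem_ball_zero_iff] at hz
  have h1 := hasSum_taylorCoeff hf (z := (r:ℂ) * z) (by
    rw [norm_mul, Complex.norm_real, Real.norm_of_nonneg hr.1]
    nlinarith [hr.1, hr.2, norm_nonneg z])
  simp only [mul_pow, ← mul_assoc] at h1
  have h2 := (hasSum_nat_add_iff' n).2 h1
  refine h2.norm_le_of_bounded
    ((summable_nat_add_iff n).2 (summable_norm_taylorCoeff hf hr)).hasSum fun k => ?_
  rw [norm_mul, norm_mul, norm_pow, norm_pow, Complex.norm_real, Real.norm_of_nonneg hr.1]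
  exact mul_le_of_le_one_right (mul_nonneg (norm_nonneg _) (pow_nonneg hr.1 _))
    (pow_le_one₀ (norm_nonneg _) hz.le)

theorem inApq_dilateF {ω : ℝ → ℝ} (hω : IsRadialWeight ω) {p q : ℝ} (hp : 0 < p) (hq : 0 < q)
    {f : ℂ → ℂ} (hf : DifferentiableOn ℂ f (Metric.ball 0 1)) {r : ℝ} (hr : r ∈ Ico (0:ℝ) 1) :
    InApq ω p q (dilateF f r) := by
  refine (inApq_of_bound hω hp hq (differentiableOn_dilateF hf ⟨hr.1, hr.2.le⟩)
    (B := ∑' k, ‖taylorCoeff f (k + 0)‖ * r ^ (k + 0)) fun z hz => ?_).1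
  simpa using norm_dilateF_sub_sum_le hf hr 0 hz

/-- A bounded functional acts on dilations coefficientwise. -/
theorem tendsto_sum_dilateF {ω : ℝ → ℝ} (hω : IsRadialWeight ω) {p q : ℝ} (hp : 0 < p)
    (hq : 0 < q) {L : (ℂ → ℂ) → ℂ} (hL : IsLinearOn (InApq ω p q) L) {M : ℝ} (hM : 0 ≤ M)
    (hLM : ∀ f, InApq ω p q f → ‖L f‖ ≤ M * (LpqNormE ω p q f).toReal)
    {f : ℂ → ℂ} (hf : DifferentiableOn ℂ f (Metric.ball 0 1)) {r : ℝ} (hr : r ∈ Ico (0:ℝ) 1) :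
    Tendsto (fun n => ∑ k ∈ Finset.range n, taylorCoeff f k * (r:ℂ) ^ k * L (fun z => z ^ k)) atTop
      (nhds (L (dilateF f r))) := by
  rw [tendsto_iff_norm_sub_tendsto_zero]
  have hlim := ((tendsto_sum_nat_add fun k => ‖taylorCoeff f k‖ * r ^ k).mul_const
    (omegaHat ω 0 ^ (1 / q))).const_mul M
  rw [zero_mul, mul_zero] at hlim
  refine squeeze_zero (fun n => norm_nonneg _) (fun n => ?_) hlim
  have hP := inApq_sum_pow hω hp hq (fun k => taylorCoeff f k * (r:ℂ) ^ k) n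
  have hd := inApq_of_bound hω hp hq
    ((differentiableOn_dilateF hf ⟨hr.1, hr.2.le⟩).sub hP.1) fun z hz =>
      norm_dilateF_sub_sum_le hf hr n hz
  rw [← hL.map_sum_pow hω hp hq, norm_sub_rev, ← hL.map_sub hP hd.1]
  exact (hLM _ hd.1).trans (mul_le_mul_of_nonneg_left hd.2 hM)

theorem meanN_dilateF (p : ℝ) (f : ℂ → ℂ) (r s : ℝ) :
    meanN p (dilateF f r) s = meanN p f (r * s) := by
  simp only [meanN, dilateF, circlePt, Complex.ofReal_mul, mul_assoc]

theorem meanN_sub_dilateF_le {p : ℝ} (hp : 1 < p) {f : ℂ → ℂ}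
    (hf : DifferentiableOn ℂ f (Metric.ball 0 1)) {r : ℝ} (hr : r ∈ Icc (0:ℝ) 1) {s : ℝ}
    (hs : s ∈ Ico (0:ℝ) 1) : meanN p (f - dilateF f r) s ≤ 2 * meanN p f s := by
  have h1 := cnorm_add_le hp.le (continuous_comp_circlePt hf hs)
    (ψ := fun θ => -dilateF f r (circlePt s θ))
    (continuous_comp_circlePt (differentiableOn_dilateF hf hr) hs).neg
  have h2 : cnorm p (fun θ => -dilateF f r (circlePt s θ)) = meanN p f (r * s) := by
    rw [← meanN_dilateF, meanN]
    exact cnorm_congr_norm p fun θ => norm_neg _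
  have h3 : meanN p f (r * s) ≤ meanN p f s :=
    monotoneOn_meanN hp hf ⟨mul_nonneg hr.1 hs.1, by nlinarith [hs.1, hs.2, hr.2]⟩ hs
      (mul_le_of_le_one_left hs.1 hr.2)
  rw [h2] at h1
  simp only [← sub_eq_add_neg] at h1
  exact h1.trans (by rw [two_mul]; exact add_le_add le_rfl h3)

theorem tendsto_meanN_sub_dilateF {p : ℝ} {f : ℂ → ℂ}
    (hf : DifferentiableOn ℂ f (Metric.ball 0 1)) {s : ℝ} (hs : s ∈ Ico (0:ℝ) 1) :
    Tendsto (fun r => meanN p (f - dilateF f r) s) (nhdsWithin 1 (Iio 1)) (nhds 0) := by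
  have huc := (isCompact_closedBall (0:ℂ) s).uniformContinuousOn_of_continuous
    (hf.continuousOn.mono (Metric.closedBall_subset_ball hs.2))
  rw [Metric.uniformContinuousOn_iff] at huc
  refine Metric.tendsto_nhds.2 fun ε hε => ?_
  obtain ⟨δ, hδ, h⟩ := huc (ε / 2) (by positivity)
  filter_upwards [Ioo_mem_nhdsLT (show max 0 (1 - δ) < 1 by simp [hδ])] with r hr
  rw [mem_Ioo, max_lt_iff] at hr
  rw [Real.dist_0_eq_abs, abs_of_nonneg (meanN_nonneg _ _ _)]
  refine lt_of_le_of_lt (cnorm_le_of_bound fun θ => ?_) (half_lt_self hε)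
  rw [Pi.sub_apply, dilateF, ← dist_eq_norm]
  have hn : ‖circlePt s θ‖ = s := by rw [norm_circlePt, abs_of_nonneg hs.1]
  refine (h _ (by simp [hn]) _ ?_ ?_).le
  · rw [mem_closedBall_zero_iff, norm_mul, hn, Complex.norm_real, Real.norm_of_nonneg hr.1.1.le]
    exact mul_le_of_le_one_left hs.1 hr.2.le
  · rw [dist_eq_norm, show circlePt s θ - (r:ℂ) * circlePt s θ = ((1 - r : ℝ) : ℂ) * circlePt s θ by
      push_cast; ring, norm_mul, hn, Complex.norm_real, Real.norm_of_nonneg (by linarith [hr.2])]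
    nlinarith [hr.2, hr.1.2, hs.1, hs.2]

theorem norm_integrand_sub_dilateF_le {ω : ℝ → ℝ} (hω : IsRadialWeight ω) {p q : ℝ} (hp : 1 < p)
    (hq : 0 < q) {f : ℂ → ℂ} (hf : DifferentiableOn ℂ f (Metric.ball 0 1)) {r : ℝ}
    (hr : r ∈ Icc (0:ℝ) 1) {s : ℝ} (hs : s ∈ Ioo (0:ℝ) 1) :
    meanN p (f - dilateF f r) s ^ q * (s * ω s) ≤ 2 ^ q * (meanN p f s ^ q * (s * ω s)) := by
  have hs' : s ∈ Ico (0:ℝ) 1 := ⟨hs.1.le, hs.2⟩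
  rw [← mul_assoc (2 ^ q), ← Real.mul_rpow zero_le_two (meanN_nonneg _ _ _)]
  exact mul_le_mul_of_nonneg_right (Real.rpow_le_rpow (meanN_nonneg _ _ _)
    (meanN_sub_dilateF_le hp hf hr hs') hq.le) (mul_nonneg hs.1.le (hω.1 s hs'))

theorem inApq_sub_dilateF {ω : ℝ → ℝ} (hω : IsRadialWeight ω) {p q : ℝ} (hp : 1 < p)
    (hq : 0 < q) {f : ℂ → ℂ} (hf : InApq ω p q f) {r : ℝ} (hr : r ∈ Icc (0:ℝ) 1) :
    InApq ω p q (f - dilateF f r) := by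
  have hi := (hf.integrableOn hω hp hq).const_mul (2 ^ q)
  refine inApq_of_lintegral_le (by linarith) hq (hf.1.sub (differentiableOn_dilateF hf.1 hr))
    (B := ∫ s in Ioo (0:ℝ) 1, 2 ^ q * (meanN p f s ^ q * (s * ω s))) ?_
  rw [ofReal_integral_eq_lintegral_ofReal hi]
  · exact setLIntegral_mono' measurableSet_Ioo fun s hs =>
      ENNReal.ofReal_le_ofReal (norm_integrand_sub_dilateF_le hω hp hq hf.1 hr hs)
  · filter_upwards [ae_restrict_mem measurableSet_Ioo] with s hs
    exact mul_nonneg (by positivity) (norm_integrand_nonneg hω p q f hs)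

/-- Dilations converge in the mixed norm space. -/
theorem tendsto_norm_sub_dilateF {ω : ℝ → ℝ} (hω : IsRadialWeight ω) {p q : ℝ} (hp : 1 < p)
    (hq : 0 < q) {f : ℂ → ℂ} (hf : InApq ω p q f) :
    Tendsto (fun r => (LpqNormE ω p q (f - dilateF f r)).toReal) (nhdsWithin 1 (Iio 1))
      (nhds 0) := by
  have hev : ∀ᶠ r : ℝ in nhdsWithin 1 (Iio 1), r ∈ Icc (0:ℝ) 1 := by
    filter_upwards [Ioo_mem_nhdsLT (zero_lt_one' ℝ)] with r hr
    exact ⟨hr.1.le, hr.2.le⟩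
  have key : Tendsto (fun r => ∫ s in Ioo (0:ℝ) 1, meanN p (f - dilateF f r) s ^ q * (s * ω s))
      (nhdsWithin 1 (Iio 1)) (nhds (∫ s in Ioo (0:ℝ) 1, 0)) := by
    refine tendsto_integral_filter_of_dominated_convergence _ ?_ ?_
      ((hf.integrableOn hω hp hq).const_mul (2 ^ q)) ?_
    · exact hev.mono fun r hr => aestronglyMeasurable_norm_integrand hω hp q
        (inApq_sub_dilateF hω hp hq hf hr).1
    · refine hev.mono fun r hr => ?_
      filter_upwards [ae_restrict_mem measurableSet_Ioo] with s hs
      rw [Real.norm_of_nonneg (norm_integrand_nonneg hω p q _ hs)]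
      exact norm_integrand_sub_dilateF_le hω hp hq hf.1 hr hs
    · filter_upwards [ae_restrict_mem measurableSet_Ioo] with s hs
      have := ((tendsto_meanN_sub_dilateF (p := p) hf.1 ⟨hs.1.le, hs.2⟩).rpow_const
        (p := q) (Or.inr hq.le)).mul_const (s * ω s)
      rwa [Real.zero_rpow hq.ne', zero_mul] at this
  rw [integral_zero] at key
  have key2 := key.rpow_const (p := 1 / q) (Or.inr (by positivity))
  rw [Real.zero_rpow (by positivity)] at key2
  refine key2.congr' (hev.mono fun r hr => ?_)
  rw [← (inApq_sub_dilateF hω hp hq hf hr).norm_rpow hω hp hq,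
    ← Real.rpow_mul ENNReal.toReal_nonneg, mul_one_div_cancel hq.ne', Real.rpow_one]

theorem tendsto_map_dilateF {ω : ℝ → ℝ} (hω : IsRadialWeight ω) {p q : ℝ} (hp : 1 < p)
    (hq : 0 < q) {L : (ℂ → ℂ) → ℂ} (hL : IsLinearOn (InApq ω p q) L) {M : ℝ}
    (hLM : ∀ f, InApq ω p q f → ‖L f‖ ≤ M * (LpqNormE ω p q f).toReal)
    {f : ℂ → ℂ} (hf : InApq ω p q f) :
    Tendsto (fun r => L (dilateF f r)) (nhdsWithin 1 (Iio 1)) (nhds (L f)) := by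
  rw [tendsto_iff_norm_sub_tendsto_zero]
  have hlim := (tendsto_norm_sub_dilateF hω hp hq hf).const_mul M
  rw [mul_zero] at hlim
  refine squeeze_zero' (.of_forall fun r => norm_nonneg _) ?_ hlim
  filter_upwards [Ioo_mem_nhdsLT (zero_lt_one' ℝ)] with r hr
  have hd := inApq_sub_dilateF hω hp hq hf ⟨hr.1.le, hr.2.le⟩
  rw [norm_sub_rev, ← hL.map_sub (inApq_dilateF hω (by linarith) hq hf.1 ⟨hr.1.le, hr.2⟩) hd]
  exact hLM _ hd

theorem nonneg_of_bound {ω : ℝ → ℝ} (hω : IsRadialWeight ω) (hW : 0 < omegaHat ω 0) {C : ℝ}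
    (hC : 0 < C) (hD : ∀ r ∈ Ico (0:ℝ) 1, omegaHat ω r ≤ C * omegaHat ω ((1 + r) / 2))
    {p q : ℝ} (hp : 1 < p) (hq : 0 < q) {L : (ℂ → ℂ) → ℂ} {M : ℝ}
    (hLM : ∀ f, InApq ω p q f → ‖L f‖ ≤ M * (LpqNormE ω p q f).toReal) : 0 ≤ M := by
  have h1 := (inApq_pow hω (zero_lt_one.trans hp) hq (ω := ω) 0).1
  have h2 := meanN_rpow_mul_omegaHat_le hω hC hD hp hq h1 (s := 0) (by simp)
  have h3 : meanN p (fun z => z ^ 0) 0 = 1 := by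
    have h0 : ENNReal.ofReal p ≠ 0 := by simpa using hp.le.trans_lt' one_pos
    simp only [meanN, cnorm, pow_zero]
    rw [eLpNorm_const _ h0 (IsProbabilityMeasure.ne_zero _)]
    simp
  rw [h3, Real.one_rpow, one_mul] at h2
  have h4 : 0 < (LpqNormE ω p q fun z => z ^ 0).toReal := by
    rcases (ENNReal.toReal_nonneg (a := LpqNormE ω p q fun z => z ^ 0)).eq_or_lt with h | h
    · rw [← h, Real.zero_rpow hq.ne'] at h2; linarith
    · exact h
  exact nonneg_of_mul_nonneg_left ((norm_nonneg _).trans (hLM _ h1)) h4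

theorem norm_multiplier_poly_le {p q : ℝ} (hp : 1 < p) (hq : 0 < q) {C : ℝ} (hC : 0 < C) :
    ∃ E : ℝ, 0 ≤ E ∧ ∀ ω : ℝ → ℝ, IsRadialWeight ω → (∀ r ∈ Ico (0:ℝ) 1, 0 < omegaHat ω r) →
      (∀ r ∈ Ico (0:ℝ) 1, omegaHat ω r ≤ C * omegaHat ω ((1 + r) / 2)) →
      ∀ r ∈ Ico (0:ℝ) 1, ∀ (c : ℤ →₀ ℂ) (N : ℕ), (∀ n : ℤ, (N:ℤ) < n → c n = 0) →
        (LpqNormE ω p q fun z => ∑ k ∈ Finset.range (N + 1),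
          ((r ^ k / momentCoeff (fun r => ω r * omegaHat ω r ^ (1 / q)) k : ℝ) : ℂ) * c (k:ℤ) *
            z ^ k).toReal ≤ E / omegaHat ω r * cnorm p (trigEval c) := by
  obtain ⟨K, hK0, hK⟩ := riesz_freqProj hp
  obtain ⟨B, hB0, hB⟩ := lintegral_max_omegaHat_rpow_le hq
  have ha : 0 ≤ 1 / q := by positivity
  refine ⟨9 * (4 / 3 * (2 * C ^ 2) ^ (1 + 1 / q)) * K * B ^ (1 / q), by positivity,
    fun ω hω hpos hD r hr c N hN => ?_⟩
  set κ := momentCoeff fun r => ω r * omegaHat ω r ^ (1 / q) with hκ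
  set F : ℂ → ℂ := fun z => ∑ k ∈ Finset.range (N + 1),
    ((r ^ k / κ k : ℝ) : ℂ) * c (k:ℤ) * z ^ k with hF
  set H := cnorm p (trigEval c) with hH
  have hH0 : 0 ≤ H := cnorm_nonneg _ _
  have hw := hpos r hr
  set w := omegaHat ω r with hwdef
  set A := 9 * (4 / 3 * (2 * C ^ 2) ^ (1 + 1 / q)) * (K * H) with hA
  have hA0 : 0 ≤ A := by positivity
  have hmean : ∀ s ∈ Ioo (0:ℝ) 1,
      meanN p F s ≤ A * max (omegaHat ω s) w ^ (-(1 + 1 / q)) := fun s hs => by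
    have hx : r * s ∈ Ico (0:ℝ) 1 := ⟨mul_nonneg hr.1 hs.1.le, by nlinarith [hr.1, hr.2, hs.1, hs.2]⟩
    have h1 := cnorm_pow_div_multiplier_le hp hK0 hK (antitone_momentCoeff hω ha)
      (momentCoeff_pos hω hpos ha) hx.1 hx.2 (pow_le_momentCoeff hω hpos hC hD ha hx) c hN
    have h2 : meanN p F s = cnorm p (fun θ => ∑ k ∈ Finset.range (N + 1),
        (((r * s) ^ k / κ k : ℝ) : ℂ) * (c (k:ℤ) * Complex.exp ((k:ℂ) * θ * Complex.I))) := by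
      rw [meanN]
      congr 1; funext θ
      refine Finset.sum_congr rfl fun k _ => ?_
      rw [circlePt_pow]
      push_cast
      ring
    rw [h2]
    refine h1.trans ?_
    have hm0 : 0 < max (omegaHat ω s) w := lt_max_of_lt_right hw
    have hm : max (omegaHat ω s) w ≤ omegaHat ω (r * s) := max_le
      (antitoneOn_omegaHat hω ⟨hx.1, hx.2.le⟩ ⟨hs.1.le, hs.2.le⟩
        (mul_le_of_le_one_left hs.1.le hr.2.le))
      (antitoneOn_omegaHat hω ⟨hx.1, hx.2.le⟩ ⟨hr.1, hr.2.le⟩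
        (mul_le_of_le_one_right hr.1 hs.2.le))
    have h3 : (2 * C ^ 2 / omegaHat ω (r * s)) ^ (1 + 1 / q) ≤
        (2 * C ^ 2) ^ (1 + 1 / q) * max (omegaHat ω s) w ^ (-(1 + 1 / q)) := by
      rw [Real.rpow_neg hm0.le, ← div_eq_mul_inv, ← Real.div_rpow (by positivity) hm0.le]
      have : 0 < omegaHat ω (r * s) := hm0.trans_le hm
      gcongr
    calc 9 * (4 / 3 * (2 * C ^ 2 / omegaHat ω (r * s)) ^ (1 + 1 / q)) * (K * H)
        ≤ 9 * (4 / 3 * ((2 * C ^ 2) ^ (1 + 1 / q) * max (omegaHat ω s) w ^ (-(1 + 1 / q)))) *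
          (K * H) := by gcongr
      _ = _ := by rw [hA]; ring
  have hint : ∫⁻ s in Ioo (0:ℝ) 1, ENNReal.ofReal (meanN p F s ^ q * (s * ω s)) ≤
      ENNReal.ofReal (A ^ q * (B * w ^ (-q))) := by
    rw [ENNReal.ofReal_mul (by positivity)]
    refine le_trans ?_ (mul_le_mul_right (hB ω hω w hw) _)
    rw [← lintegral_const_mul' _ _ ENNReal.ofReal_ne_top]
    refine setLIntegral_mono' measurableSet_Ioo fun s hs => ?_
    rw [← ENNReal.ofReal_mul (by positivity)]
    refine ENNReal.ofReal_le_ofReal ?_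
    have hω0 := hω.1 s ⟨hs.1.le, hs.2⟩
    have hm0 : 0 < max (omegaHat ω s) w := lt_max_of_lt_right hw
    have h1 := Real.rpow_le_rpow (meanN_nonneg _ _ _) (hmean s hs) hq.le
    rw [Real.mul_rpow hA0 (by positivity), ← Real.rpow_mul hm0.le,
      show -(1 + 1 / q) * q = -(1 + q) by field_simp; ring] at h1
    rw [← mul_assoc (A ^ q)]
    exact mul_le_mul h1 (mul_le_of_le_one_left hω0 hs.2.le) (mul_nonneg hs.1.le hω0) (by positivity)
  refine (LpqNormE_toReal_le_of_lintegral_le (by linarith) hq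
    (by rw [hF]; fun_prop) (by positivity) hint).trans_eq ?_
  rw [Real.mul_rpow (by positivity) (by positivity), Real.mul_rpow hB0 (by positivity),
    ← Real.rpow_mul hA0, ← Real.rpow_mul hw.le, mul_one_div_cancel hq.ne', neg_mul,
    mul_one_div_cancel hq.ne', Real.rpow_one, Real.rpow_neg_one, hA]
  field_simp

theorem summable_div_momentCoeff {ω : ℝ → ℝ} (hω : IsRadialWeight ω)
    (hpos : ∀ r ∈ Ico (0:ℝ) 1, 0 < omegaHat ω r) {C : ℝ} (hC : 0 < C)
    (hD : ∀ r ∈ Ico (0:ℝ) 1, omegaHat ω r ≤ C * omegaHat ω ((1 + r) / 2)) {a : ℝ} (ha : 0 ≤ a)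
    {u : ℕ → ℂ} {U : ℝ} (hu : ∀ k, ‖u k‖ ≤ U) {r : ℝ} (hr : r ∈ Ico (0:ℝ) 1) :
    Summable fun k => ‖u k / ((momentCoeff (fun r => ω r * omegaHat ω r ^ a) k : ℝ) : ℂ)‖ *
      r ^ k := by
  set κ := momentCoeff fun r => ω r * omegaHat ω r ^ a with hκ
  set y := (3 + r) / 4 with hy
  have hy0 : 0 < y := by rw [hy]; linarith [hr.1]
  have hratio : r / y ^ 2 < 1 := by
    rw [div_lt_one (by positivity), hy]
    nlinarith [hr.1, hr.2, mul_pos (sub_pos.2 hr.2) (show 0 < 9 - r by linarith [hr.2])]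
  set D := 4 / 3 * (2 * C ^ 2 / omegaHat ω r) ^ (1 + a) with hDdef
  refine Summable.of_nonneg_of_le (fun k => mul_nonneg (norm_nonneg _) (pow_nonneg hr.1 _))
    (fun k => ?_) ((summable_geometric_of_lt_one (div_nonneg hr.1 (by positivity)) hratio).mul_left
      (U * D))
  have hk : 0 < κ k := momentCoeff_pos hω hpos ha k
  have h1 : y ^ (2 * k) ≤ D * κ k := pow_le_momentCoeff hω hpos hC hD ha hr k
  have hU : 0 ≤ U := (norm_nonneg _).trans (hu 0)
  rw [norm_div, Complex.norm_real, Real.norm_of_nonneg hk.le, div_pow, ← pow_mul]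
  rw [div_mul_eq_mul_div, mul_div_assoc', div_le_div_iff₀ hk (by positivity)]
  calc ‖u k‖ * r ^ k * y ^ (2 * k) ≤ U * r ^ k * (D * κ k) := by
        have := pow_nonneg hr.1 k
        gcongr
        exact hu k
    _ = _ := by ring

theorem integral_mul_conj_trigEval_eq_sum {g : ℂ → ℂ}
    (hg : DifferentiableOn ℂ g (Metric.ball 0 1)) {r : ℝ} (hr : r ∈ Ico (0:ℝ) 1) (c : ℤ →₀ ℂ)
    {N : ℕ} (hN : ∀ n : ℤ, (N:ℤ) < n → c n = 0) :
    ∫ θ : ℝ, g (circlePt r θ) * (starRingEnd ℂ) (trigEval c θ) ∂circMeas =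
      ∑ k ∈ Finset.range (N + 1), (starRingEnd ℂ) (c (k:ℤ)) * (taylorCoeff g k * (r:ℂ) ^ k) := by
  rw [integral_mul_conj_trigEval (continuous_comp_circlePt hg hr)]
  simp only [integral_circlePt_mul_conj_exp hg hr]
  set h : ℤ → ℂ := fun n => (starRingEnd ℂ) (c n) *
    if 0 ≤ n then taylorCoeff g n.toNat * (r:ℂ) ^ n.toNat else 0 with hh
  set T : Finset ℤ := (Finset.range (N + 1)).map Nat.castEmbedding with hT
  have h1 : ∑ n ∈ c.support, h n = ∑ n ∈ c.support ∪ T, h n :=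
    Finset.sum_subset Finset.subset_union_left fun n _ hn => by
      simp [hh, Finsupp.notMem_support_iff.1 hn]
  have h2 : ∑ n ∈ T, h n = ∑ n ∈ c.support ∪ T, h n :=
    Finset.sum_subset Finset.subset_union_right fun n _ hn => by
      by_cases hn0 : 0 ≤ n
      · have : (N:ℤ) < n := by
          by_contra! hle
          refine hn (Finset.mem_map.2 ⟨n.toNat, Finset.mem_range.2 (by omega), ?_⟩)
          simp [hn0]
        simp [hh, hN n this]
      · simp [hh, hn0]
  change ∑ n ∈ c.support, h n = _
  rw [h1, ← h2, hT, Finset.sum_map]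
  refine Finset.sum_congr rfl fun k _ => ?_
  simp [hh]

theorem exists_forall_lt_eq_zero (c : ℤ →₀ ℂ) : ∃ N : ℕ, ∀ n : ℤ, (N:ℤ) < n → c n = 0 := by
  refine ⟨c.support.sup Int.toNat, fun n hn => ?_⟩
  by_contra h
  have := Finset.le_sup (f := Int.toNat) (Finsupp.mem_support_iff.2 h)
  omega

theorem inApInf_of_meanN_le {ω : ℝ → ℝ} {p : ℝ} (hp : 0 < p) {g : ℂ → ℂ}
    (hg : DifferentiableOn ℂ g (Metric.ball 0 1)) {B : ℝ} (hB : 0 ≤ B)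
    (h : ∀ r ∈ Ico (0:ℝ) 1, meanN p g r * omegaHat ω r ≤ B) :
    InApInf ω p g ∧ (ApInfNormE ω p g).toReal ≤ B := by
  have h1 : ApInfNormE ω p g ≤ ENNReal.ofReal B := iSup₂_le fun r hr => by
    rw [MpE_eq_ofReal hp hg hr, ← ENNReal.ofReal_mul (meanN_nonneg _ _ _)]
    exact ENNReal.ofReal_le_ofReal (h r hr)
  exact ⟨⟨hg, h1.trans_lt ENNReal.ofReal_lt_top⟩, ENNReal.toReal_le_of_le_ofReal hB h1⟩

/-- The symbol representing a functional `L` with respect to the pairing with coefficients `κ`. -/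
def symbolOf (κ : ℕ → ℝ) (L : (ℂ → ℂ) → ℂ) (z : ℂ) : ℂ :=
  ∑' k : ℕ, (starRingEnd ℂ) (L fun z => z ^ k) / ((κ k : ℝ) : ℂ) * z ^ k

theorem summable_symbolOf {ω : ℝ → ℝ} (hω : IsRadialWeight ω)
    (hpos : ∀ r ∈ Ico (0:ℝ) 1, 0 < omegaHat ω r) {C : ℝ} (hC : 0 < C)
    (hD : ∀ r ∈ Ico (0:ℝ) 1, omegaHat ω r ≤ C * omegaHat ω ((1 + r) / 2))
    {p q : ℝ} (hp : 0 < p) (hq : 0 < q) {L : (ℂ → ℂ) → ℂ} {M : ℝ} (hM : 0 ≤ M)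
    (hLM : ∀ f, InApq ω p q f → ‖L f‖ ≤ M * (LpqNormE ω p q f).toReal) :
    ∀ r ∈ Ico (0:ℝ) 1, Summable fun k : ℕ => ‖(starRingEnd ℂ) (L fun z => z ^ k) /
      ((momentCoeff (fun r => ω r * omegaHat ω r ^ (1 / q)) k : ℝ) : ℂ)‖ * r ^ k :=
  fun r hr => summable_div_momentCoeff hω hpos hC hD (by positivity)
    (U := M * omegaHat ω 0 ^ (1 / q)) (fun k => by
      rw [RCLike.norm_conj]
      exact (hLM _ (inApq_pow hω hp hq k).1).trans
        (mul_le_mul_of_nonneg_left (inApq_pow hω hp hq k).2 hM)) hr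

theorem symbolOf_bound {p q p' : ℝ} (hpp : p.HolderConjugate p') (hq : 0 < q) {C : ℝ}
    (hC : 0 < C) :
    ∃ E : ℝ, 0 < E ∧ ∀ ω : ℝ → ℝ, IsRadialWeight ω → (∀ r ∈ Ico (0:ℝ) 1, 0 < omegaHat ω r) →
      (∀ r ∈ Ico (0:ℝ) 1, omegaHat ω r ≤ C * omegaHat ω ((1 + r) / 2)) →
      ∀ (L : (ℂ → ℂ) → ℂ) (M : ℝ), IsLinearOn (InApq ω p q) L → 0 ≤ M →
      (∀ f, InApq ω p q f → ‖L f‖ ≤ M * (LpqNormE ω p q f).toReal) →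
      InApInf ω p' (symbolOf (momentCoeff fun r => ω r * omegaHat ω r ^ (1 / q)) L) ∧
      (ApInfNormE ω p' (symbolOf (momentCoeff fun r => ω r * omegaHat ω r ^ (1 / q)) L)).toReal ≤
        E * M := by
  obtain ⟨E, hE0, hE⟩ := norm_multiplier_poly_le hpp.lt hq hC
  refine ⟨4 * E + 1, by positivity, fun ω hω hpos hD L M hL hM hLM => ?_⟩
  have hsum := summable_symbolOf hω hpos hC hD hpp.pos hq hM hLM
  set κ := momentCoeff fun r => ω r * omegaHat ω r ^ (1 / q) with hκ
  have hg : DifferentiableOn ℂ (symbolOf κ L) (Metric.ball 0 1) := differentiableOn_tsum_pow hsum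
  refine inApInf_of_meanN_le hpp.symm.pos hg (by positivity) fun r hr => ?_
  have hw := hpos r hr
  have key : meanN p' (symbolOf κ L) r ≤ 4 * (M * (E / omegaHat ω r)) := by
    refine cnorm_le_of_posTrig hpp.symm (continuous_comp_circlePt hg hr)
      (periodic_comp_circlePt _ r) (by positivity) fun c _ => ?_
    obtain ⟨N, hN⟩ := exists_forall_lt_eq_zero c
    have hF := inApq_sum_pow hω hpp.pos hq (fun k => ((r ^ k / κ k : ℝ) : ℂ) * c (k:ℤ)) (N + 1)
    have hLF := hL.map_sum_pow hω hpp.pos hq (fun k => ((r ^ k / κ k : ℝ) : ℂ) * c (k:ℤ)) (N + 1)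
    have h1 : ∫ θ : ℝ, symbolOf κ L (circlePt r θ) * (starRingEnd ℂ) (trigEval c θ) ∂circMeas =
        (starRingEnd ℂ) (L fun z => ∑ k ∈ Finset.range (N + 1),
          ((r ^ k / κ k : ℝ) : ℂ) * c (k:ℤ) * z ^ k) := by
      rw [integral_mul_conj_trigEval_eq_sum hg hr c hN, hLF, map_sum]
      refine Finset.sum_congr rfl fun k _ => ?_
      have h2 : taylorCoeff (symbolOf κ L) k = _ := taylorCoeff_tsum_pow hsum k
      rw [h2]
      simp only [map_mul, Complex.conj_ofReal]
      push_cast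
      ring
    rw [h1, RCLike.norm_conj, mul_assoc]
    exact (hLM _ hF).trans (mul_le_mul_of_nonneg_left (hE ω hω hpos hD r hr c N hN) hM)
  calc meanN p' (symbolOf κ L) r * omegaHat ω r
      ≤ 4 * (M * (E / omegaHat ω r)) * omegaHat ω r := mul_le_mul_of_nonneg_right key hw.le
    _ = 4 * E * M := by field_simp
    _ ≤ _ := by nlinarith

theorem hasPairing_symbolOf {ω : ℝ → ℝ} (hω : IsRadialWeight ω)
    (hpos : ∀ r ∈ Ico (0:ℝ) 1, 0 < omegaHat ω r) {C : ℝ} (hC : 0 < C)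
    (hD : ∀ r ∈ Ico (0:ℝ) 1, omegaHat ω r ≤ C * omegaHat ω ((1 + r) / 2))
    {p q : ℝ} (hp : 1 < p) (hq : 0 < q) {L : (ℂ → ℂ) → ℂ} (hL : IsLinearOn (InApq ω p q) L)
    {M : ℝ} (hM : 0 ≤ M) (hLM : ∀ f, InApq ω p q f → ‖L f‖ ≤ M * (LpqNormE ω p q f).toReal)
    {f : ℂ → ℂ} (hf : InApq ω p q f) :
    HasPairingC (momentCoeff fun r => ω r * omegaHat ω r ^ (1 / q)) f
      (symbolOf (momentCoeff fun r => ω r * omegaHat ω r ^ (1 / q)) L) (L f) := by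
  have hp0 : 0 < p := by linarith
  have ha : 0 ≤ 1 / q := by positivity
  have hsum := summable_symbolOf hω hpos hC hD hp0 hq hM hLM
  have hg : DifferentiableOn ℂ (symbolOf (momentCoeff fun r => ω r * omegaHat ω r ^ (1 / q)) L)
    (Metric.ball 0 1) := differentiableOn_tsum_pow hsum
  have hS := fun (r : ℝ) (hr : r ∈ Ico (0:ℝ) 1) => (hasSum_pairing hω ha hf.1 hg hr).summable
  refine ⟨hS, (tendsto_map_dilateF hω hp hq hL hLM hf).congr' ?_⟩
  filter_upwards [Ioo_mem_nhdsLT (zero_lt_one' ℝ)] with r hr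
  have hr' : r ∈ Ico (0:ℝ) 1 := ⟨hr.1.le, hr.2⟩
  refine tendsto_nhds_unique (tendsto_sum_dilateF hω hp0 hq hL hM hLM hf.1 hr') ?_
  refine (hS r hr').hasSum.tendsto_sum_nat.congr fun n => Finset.sum_congr rfl fun k _ => ?_
  have hk := momentCoeff_pos hω hpos ha k
  have h2 : taylorCoeff (symbolOf (momentCoeff fun r => ω r * omegaHat ω r ^ (1 / q)) L) k = _ :=
    taylorCoeff_tsum_pow hsum k
  have hk' : ((momentCoeff (fun r => ω r * omegaHat ω r ^ (1 / q)) k : ℝ) : ℂ) ≠ 0 :=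
    Complex.ofReal_ne_zero.2 hk.ne'
  rw [h2, map_div₀, Complex.conj_conj, Complex.conj_ofReal]
  field_simp

/-- For `ω ∈ D̂`, `1<p<∞` and `0<q≤1`, `(A^{p,q}_ω)* ≃ A^{p',∞}_ω` under the
`A²_{μ_q}`-pairing, `μ_q = ω ω̂^{1/q}`, with equivalence of norms. -/
theorem duality_Apq_plarge_qsmall
    (ω : ℝ → ℝ) (hω : IsRadialWeight ω)
    (hpos : ∀ r ∈ Set.Ico (0:ℝ) 1, 0 < omegaHat ω r)
    (hD : InDhat ω)
    (p q p' : ℝ) (hp : 1 < p) (hq0 : 0 < q) (hq1 : q ≤ 1)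
    (hp' : p' = p / (p - 1))
    (μq : ℝ → ℝ) (hμq : μq = fun r => ω r * omegaHat ω r ^ (1 / q)) :
    ∃ C₁ > (0:ℝ), ∃ C₂ > (0:ℝ),
      (∀ g : ℂ → ℂ, InApInf ω p' g → ∀ f : ℂ → ℂ, InApq ω p q f →
        ∃ l : ℂ, HasPairingC (momentCoeff μq) f g l ∧
          ‖l‖ ≤ C₂ * (ApInfNormE ω p' g).toReal * (LpqNormE ω p q f).toReal) ∧
      (∀ L : (ℂ → ℂ) → ℂ, IsLinearOn (InApq ω p q) L →
        (∃ M : ℝ, ∀ f : ℂ → ℂ, InApq ω p q f → ‖L f‖ ≤ M * (LpqNormE ω p q f).toReal) →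
        ∃ g : ℂ → ℂ, InApInf ω p' g ∧
          (∀ f : ℂ → ℂ, InApq ω p q f → HasPairingC (momentCoeff μq) f g (L f)) ∧
          (∀ M : ℝ, (∀ f : ℂ → ℂ, InApq ω p q f → ‖L f‖ ≤ M * (LpqNormE ω p q f).toReal) →
            (ApInfNormE ω p' g).toReal ≤ C₁ * M)) := by
  obtain ⟨C, hC, hD⟩ := hD
  subst hμq
  have hpp : p.HolderConjugate p' := hp' ▸ Real.HolderConjugate.conjExponent hp
  have hp0 : 0 < p := hpp.pos
  obtain ⟨E, hE0, hE⟩ := symbolOf_bound hpp hq0 hC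
  have hnn : ∀ (L : (ℂ → ℂ) → ℂ) (M : ℝ),
      (∀ f : ℂ → ℂ, InApq ω p q f → ‖L f‖ ≤ M * (LpqNormE ω p q f).toReal) → 0 ≤ M :=
    fun L M h => nonneg_of_bound hω (hpos 0 (by simp)) hC hD hp hq0 h
  refine ⟨E, hE0, ((2 * C) ^ (1 / q)) ^ (1 - q), by positivity,
    fun g hg f hf => exists_pairing hω hpos hC hD hpp hq0 hq1 hg hf, fun L hL ⟨M, hM⟩ => ?_⟩
  exact ⟨_, (hE ω hω hpos hD L M hL (hnn L M hM) hM).1,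
    fun f hf => hasPairing_symbolOf hω hpos hC hD hp hq0 hL (hnn L M hM) hM hf,
    fun M' hM' => (hE ω hω hpos hD L M' hL (hnn L M' hM') hM').2⟩
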